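/- arXiv:1304.2044 — 6 statements merged into one kernel-verified Lean document; each statement's English description precedes it below -/
import Mathlib

section
/- Let K be a totally real number field of degree N ≥ 2 over ℚ with ring of integers O_K, and let π₁ = id, π₂, …, π_N : K → ℝ be the N distinct real embeddings of K (applied entrywise to matrices). Fix an integer d ≥ 2. Then the set {(π₁(γ)·A, π₂(γ), …, π_N(γ)) : γ ∈ SL(d,O_K), A ∈ SL(d,ℝ)} is dense in the product group SL(d,ℝ)^N. -/
/-- The topology on `SL(k,ℝ)`, induced from the space of matrices. -/
instance (k : ℕ) : TopologicalSpace (Matrix.SpecialLinearGroup (Fin k) ℝ) :=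
  TopologicalSpace.induced
    (fun A => (A : Matrix (Fin k) (Fin k) ℝ)) inferInstance

open Matrix

section Density

variable {K : Type*} [Field K] [NumberField K]

/-- For a finite family of distinct real embeddings `σ j`, the vectors `(σ j b)_j`, with `b` running
through an integral basis, span the whole space. -/
lemma span_range_realEmbeddings_integralBasis {ι : Type*} [Finite ι] {σ : ι → (K →+* ℝ)}
    (hσ : Function.Injective σ) :
    Submodule.span ℝ (Set.range fun i => fun j => σ j (NumberField.integralBasis K i)) = ⊤ := by
  classical
  have := Fintype.ofFinite ι
  by_contra hne
  obtain ⟨f, hf0, hf⟩ := Submodule.exists_dual_map_eq_bot_of_lt_top (lt_top_iff_ne_top.mpr hne)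
    inferInstance
  apply hf0
  have hli : LinearIndependent ℝ fun j => (σ j : K → ℝ) :=
    (linearIndependent_monoidHom K ℝ).comp (fun j => (σ j : K →* ℝ)) fun j k h =>
      hσ (RingHom.ext fun x => DFunLike.congr_fun h x)
  have hfb (i) : f (fun j => σ j (NumberField.integralBasis K i)) = 0 := by
    have := Submodule.mem_map_of_mem (f := f) (Submodule.subset_span (R := ℝ)
      (Set.mem_range_self (f := fun i j => σ j (NumberField.integralBasis K i)) i))
    rwa [hf, Submodule.mem_bot] at this
  let g : K →ₗ[ℚ] ℝ := (f.restrictScalars ℚ).comp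
    (LinearMap.pi fun j => (σ j).toRatAlgHom.toLinearMap)
  have hg : g = 0 := (NumberField.integralBasis K).ext hfb
  have hsingle := Fintype.linearIndependent_iff.mp hli (fun j => f (Pi.single j 1)) <| by
    ext x
    have hx : f (fun j => σ j x) = 0 := LinearMap.congr_fun hg x
    rw [LinearMap.pi_apply_eq_sum_univ f] at hx
    have hsingle (j : ι) : (fun k => if j = k then (1 : ℝ) else 0) = Pi.single j 1 := by
      ext k
      simp [Pi.single_apply, eq_comm]
    simpa [hsingle, mul_comm] using hx
  refine LinearMap.pi_ext' fun j => LinearMap.ext_ring ?_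
  simpa using hsingle j

/-- There is a unit that is contracted by all real embeddings but one. -/
lemma exists_unit_forall_abs_realEmbedding_lt_one (σ₀ : K →+* ℝ) :
    ∃ u : (NumberField.RingOfIntegers K)ˣ, ∀ τ : K →+* ℝ, τ ≠ σ₀ → |τ (u : K)| < 1 := by
  obtain ⟨u, hu⟩ := NumberField.Units.dirichletUnitTheorem.exists_unit K
    (NumberField.InfinitePlace.mk (Complex.ofRealHom.comp σ₀))
  refine ⟨u, fun τ hτ => ?_⟩
  have hne : NumberField.InfinitePlace.mk (Complex.ofRealHom.comp τ) ≠
      NumberField.InfinitePlace.mk (Complex.ofRealHom.comp σ₀) := by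
    rw [Ne, NumberField.InfinitePlace.mk_eq_iff]
    rintro (h | h) <;> refine hτ (RingHom.ext fun x => ?_) <;>
      simpa using RingHom.congr_fun h x
  have hlog := hu _ hne
  rw [NumberField.InfinitePlace.apply] at hlog
  have habs : ‖(Complex.ofRealHom.comp τ) (u : K)‖ = |τ (u : K)| := by simp
  rw [habs] at hlog
  contrapose! hlog
  exact Real.log_nonneg hlog

/-- Strong approximation for the additive group: the ring of integers is dense in the product of
all real completions but one. -/
lemma dense_setOf_exists_ringOfIntegers {ι : Type*} [Finite ι] {σ : ι → (K →+* ℝ)}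
    (hσ : Function.Injective σ) (j₀ : ι) :
    Dense {t : ι → ℝ | ∃ a : NumberField.RingOfIntegers K, ∀ j ≠ j₀, t j = σ j a} := by
  classical
  have := Fintype.ofFinite ι
  intro t
  rw [Metric.mem_closure_iff]
  intro ε hε
  obtain ⟨u, hu⟩ := exists_unit_forall_abs_realEmbedding_lt_one (σ j₀)
  let b := NumberField.RingOfIntegers.basis K
  let C : ι → ℝ := fun j => ∑ i, |σ j (b i)|
  have hev : ∀ᶠ n : ℕ in Filter.atTop, ∀ j, j ≠ j₀ → |σ j (u : K)| ^ n * C j < ε := by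
    rw [Filter.eventually_all]
    intro j
    by_cases hj : j = j₀
    · simp [hj]
    · have hlim := (tendsto_pow_atTop_nhds_zero_of_lt_one (abs_nonneg _)
        (hu (σ j) (hσ.ne hj))).mul_const (C j)
      rw [zero_mul] at hlim
      filter_upwards [hlim.eventually_lt_const hε] with n hn _ using hn
  obtain ⟨n, hn⟩ := hev.exists
  have hu0 (j) : σ j (u : K) ≠ 0 := by simp
  have hmem : (fun j => t j / σ j (u : K) ^ n) ∈
      Submodule.span ℝ (Set.range fun i => fun j => σ j (NumberField.integralBasis K i)) := by
    rw [span_range_realEmbeddings_integralBasis hσ]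
    trivial
  obtain ⟨c, hc⟩ := (Submodule.mem_span_range_iff_exists_fun ℝ).mp hmem
  have ht (j) : t j = σ j (u : K) ^ n * ∑ i, c i * σ j (b i) := by
    have := congrFun hc j
    simp only [Finset.sum_apply, Pi.smul_apply, smul_eq_mul,
      NumberField.integralBasis_apply] at this
    rw [this, mul_div_cancel₀ _ (pow_ne_zero _ (hu0 j))]
  let a : NumberField.RingOfIntegers K := (u : NumberField.RingOfIntegers K) ^ n * ∑ i, ⌊c i⌋ • b i
  refine ⟨fun j => if j = j₀ then t j else σ j a, ⟨a, fun j hj => if_neg hj⟩, ?_⟩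
  rw [dist_pi_lt_iff hε]
  intro j
  by_cases hj : j = j₀
  · simpa [hj] using hε
  have ha : σ j a = σ j (u : K) ^ n * ∑ i, (⌊c i⌋ : ℝ) * σ j (b i) := by
    simp [a]
  have hsub : t j - σ j a = σ j (u : K) ^ n * ∑ i, Int.fract (c i) * σ j (b i) := by
    rw [ht, ha, ← mul_sub, ← Finset.sum_sub_distrib]
    simp only [← sub_mul, Int.self_sub_floor]
  rw [if_neg hj, Real.dist_eq, hsub, abs_mul, abs_pow]
  refine lt_of_le_of_lt ?_ (hn j hj)
  gcongr
  refine (Finset.abs_sum_le_sum_abs _ _).trans (Finset.sum_le_sum fun i _ => ?_)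
  rw [abs_mul, abs_of_nonneg (Int.fract_nonneg _)]
  exact mul_le_of_le_one_left (abs_nonneg _) (Int.fract_lt_one _).le

end Density

namespace Matrix.SpecialLinearGroup

lemma diag2n_eq_transvection_prod {n F : Type*} [Fintype n] [DecidableEq n] [Field F]
    {i j : n} (hij : i ≠ j) (a : F) (ha : a ≠ 0) :
    diag2n hij a ha = transvection hij a * transvection hij.symm (-a⁻¹) * transvection hij a *
      transvection hij (-1) * transvection hij.symm 1 * transvection hij (-1) := by
  have hdiag : (diag2n hij a ha : Matrix n n F) =
      1 + single i i (a - 1) + single j j (a⁻¹ - 1) := by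
    rw [diag2n_coe]
    ext k l
    simp only [diagonal_apply, Matrix.add_apply, Matrix.one_apply, Matrix.single_apply]
    grind
  apply Subtype.ext
  simp only [hdiag, coe_mul, transvection_coe]
  simp only [mul_add, add_mul, mul_one, one_mul, single_mul_single_same,
    single_mul_single_of_ne, hij, hij.symm, ne_eq, not_false_eq_true, add_zero]
  have hsmul (k l : n) (c : F) : single k l c = c • single k l (1 : F) := by simp
  rw [hsmul i i (a - 1), hsmul j j (a⁻¹ - 1)]
  simp only [hsmul _ _ (_ * _), hsmul _ _ (-_), hsmul _ _ a]
  match_scalars <;> field_simp <;> ring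

/-- Over a field, `SL` is generated by transvections. -/
lemma closure_range_transvection_eq_top {n F : Type*} [Fintype n] [DecidableEq n] [Nontrivial n]
    [Field F] : Subgroup.closure (Set.range (TransvectionStruct.toSpecialLinearGroup :
      TransvectionStruct n F → SpecialLinearGroup n F)) = ⊤ := by
  have htrans (i j : n) (hij : i ≠ j) (c : F) : transvection hij c ∈ Subgroup.closure
      (Set.range (TransvectionStruct.toSpecialLinearGroup : TransvectionStruct n F → _)) :=
    Subgroup.subset_closure ⟨⟨i, j, hij, c⟩, rfl⟩
  refine eq_top_iff.mpr fun M _ => diagonal_transvection_induction' (· ∈ Subgroup.closure _) M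
    (fun i j hij c hc => ?_) htrans
    fun _ _ => mul_mem
  rw [diag2n_eq_transvection_prod]
  exact mul_mem (mul_mem (mul_mem (mul_mem (mul_mem (htrans _ _ _ _) (htrans _ _ _ _))
    (htrans _ _ _ _)) (htrans _ _ _ _)) (htrans _ _ _ _)) (htrans _ _ _ _)

lemma map_transvection {n R S : Type*} [Fintype n] [DecidableEq n] [CommRing R] [CommRing S]
    (f : R →+* S) {i j : n} (hij : i ≠ j) (c : R) :
    map f (transvection hij c) = transvection hij (f c) := by
  ext k l
  simp [transvection_coe, Matrix.one_apply, Matrix.single_apply, apply_ite f]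

lemma continuous_transvection {n R : Type*} [Fintype n] [DecidableEq n] [CommRing R]
    [TopologicalSpace R] [ContinuousAdd R] {i j : n} (hij : i ≠ j) :
    Continuous (transvection hij : R → SpecialLinearGroup n R) := by
  refine continuous_induced_rng.mpr (continuous_matrix fun k l => ?_)
  change Continuous fun b : R => (1 : Matrix n n R) k l + single i j b k l
  simp only [Matrix.single_apply]
  split_ifs <;> fun_prop

end Matrix.SpecialLinearGroup


/-- **Density claim of Section 2.2** (Marklof–Strömbergsson, quasicrystal paper).
For a totally real number field `K` of degree `N ≥ 2` with real embeddings
`σ_0 = id, σ_1, …, σ_{N-1}`, the set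
`{(σ_0(γ)A, σ_1(γ), …, σ_{N-1}(γ)) : γ ∈ SL(d,O_K), A ∈ SL(d,ℝ)}`
is dense in `SL(d,ℝ)^N`. -/
theorem dense_hilbertModular_orbit
    (K : Type*) [Field K] [NumberField K]
    (N : ℕ) (hN : 2 ≤ N) [NeZero N]
    (hdeg : Module.finrank ℚ K = N)
    (σ : Fin N → (K →+* ℝ)) (hσ : Function.Injective σ)
    (d : ℕ) (hd : 2 ≤ d) :
    Dense {h : Fin N → Matrix.SpecialLinearGroup (Fin d) ℝ |
      ∃ γ : Matrix.SpecialLinearGroup (Fin d) (NumberField.RingOfIntegers K),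
      ∃ A : Matrix.SpecialLinearGroup (Fin d) ℝ,
        h = Function.update
          (fun j => Matrix.SpecialLinearGroup.map
            ((σ j).comp (algebraMap (NumberField.RingOfIntegers K) K)) γ)
          0
          (Matrix.SpecialLinearGroup.map
            ((σ 0).comp (algebraMap (NumberField.RingOfIntegers K) K)) γ * A)} := by
  classical
  have : Nontrivial (Fin d) := Fin.nontrivial_iff_two_le.mpr hd
  have : IsTopologicalGroup (SpecialLinearGroup (Fin d) ℝ) :=
    SpecialLinearGroup.topologicalGroup
  let φ (j : Fin N) := SpecialLinearGroup.map (n := Fin d)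
    ((σ j).comp (algebraMap (NumberField.RingOfIntegers K) K))
  let H : Subgroup (Fin N → SpecialLinearGroup (Fin d) ℝ) :=
    { carrier := {h | ∃ γ, ∀ j ≠ 0, h j = φ j γ}
      one_mem' := ⟨1, fun j _ => by simp⟩
      mul_mem' := by
        rintro g h ⟨γ, hγ⟩ ⟨δ, hδ⟩
        exact ⟨γ * δ, fun j hj => by simp [hγ j hj, hδ j hj]⟩
      inv_mem' := by
        rintro g ⟨γ, hγ⟩
        exact ⟨γ⁻¹, fun j hj => by simp [hγ j hj]⟩ }
  have hH : (H : Set (Fin N → SpecialLinearGroup (Fin d) ℝ)) ⊆ {h | ∃ γ, ∃ A,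
      h = Function.update (fun j => φ j γ) 0 (φ 0 γ * A)} := by
    rintro h ⟨γ, hγ⟩
    refine ⟨γ, (φ 0 γ)⁻¹ * h 0, funext fun j => ?_⟩
    by_cases hj : j = 0
    · subst hj
      simp
    · simp [hj, hγ j hj]
  have htrans (i k : Fin d) (hik : i ≠ k) (t : Fin N → ℝ) :
      (fun j => SpecialLinearGroup.transvection hik (t j)) ∈ H.topologicalClosure := by
    refine map_mem_closure (f := fun (s : Fin N → ℝ) j =>
      SpecialLinearGroup.transvection hik (s j)) ?_
      (dense_setOf_exists_ringOfIntegers hσ 0 t) ?_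
    · exact continuous_pi fun j =>
        (SpecialLinearGroup.continuous_transvection hik).comp (continuous_apply j)
    · rintro s ⟨a, ha⟩
      refine ⟨SpecialLinearGroup.transvection hik a, fun j hj => ?_⟩
      simp [φ, SpecialLinearGroup.map_transvection, ha j hj]
  have hsingle (j : Fin N) (g : SpecialLinearGroup (Fin d) ℝ) :
      Pi.mulSingle j g ∈ H.topologicalClosure := by
    have hle : Subgroup.closure (Set.range (TransvectionStruct.toSpecialLinearGroup :
        TransvectionStruct (Fin d) ℝ → _)) ≤ H.topologicalClosure.comap
          (MonoidHom.mulSingle (fun _ : Fin N => SpecialLinearGroup (Fin d) ℝ) j) := by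
      rw [Subgroup.closure_le]
      rintro _ ⟨⟨i, k, hik, c⟩, rfl⟩
      change Pi.mulSingle j (SpecialLinearGroup.transvection hik c) ∈ H.topologicalClosure
      convert htrans i k hik (Pi.single j c) using 1
      ext1 l
      by_cases hl : l = j
      · subst hl
        simp
      · simp [hl]
    rw [SpecialLinearGroup.closure_range_transvection_eq_top] at hle
    exact hle (Subgroup.mem_top g)
  have hdense : Dense (H : Set (Fin N → SpecialLinearGroup (Fin d) ℝ)) := fun h =>
    Subgroup.pi_mem_of_mulSingle_mem (H := H.topologicalClosure) h fun j => hsingle j (h j)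
  exact hdense.mono hH
end

section
/- Let L ⊂ ℝⁿ be a full-rank lattice, let W₁,…,W_s be subsets of the closure A of π_int(L) in ℝ^m, and let t₁,…,t_s ∈ ℝ^d. Let b₁,…,b_r ∈ ℝⁿ be such that each t_j belongs to π(L + ℤb₁ + ⋯ + ℤb_r). Set n' = n + r, write ℝ^{n'} = ℝⁿ × ℝ^r = ℝ^d × ℝ^{m+r}, let π' : ℝ^{n'} → ℝ^d and π'_int : ℝ^{n'} → ℝ^{m+r} be the projections onto the first d and last m+r coordinates, and define the extension lattice L' = (L × {0}) + ℤ(b₁,e₁) + ⋯ + ℤ(b_r,e_r) ⊂ ℝ^{n'}, where e₁,…,e_r is the standard basis of ℝ^r (so L' is a full-rank lattice in ℝ^{n'}). For each j ∈ {1,…,s} choose v^{(j)} ∈ L and integers α₁^{(j)},…,α_r^{(j)} with t_j = π(v^{(j)} + Σ_{k=1}^r α_k^{(j)} b_k), and set m'_j = (v^{(j)},0) + Σ_{k=1}^r α_k^{(j)}(b_k,e_k) ∈ L' and W'_j = (W_j × {0}) + π'_int(m'_j) ⊂ ℝ^{m+r}. Then for each j one has t_j + P(W_j, L) = P(W'_j,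 L'), and consequently, with W' = ⋃_{j=1}^s W'_j, ⋃_{j=1}^s ( t_j + P(W_j, L) ) = P(W', L'). -/
open MeasureTheory Matrix Topology Bornology

/-- Projection of `ℝⁿ = ℝ^d × ℝ^m` onto the physical space `ℝ^d` (first `d` coordinates). -/
def projPhys (d m : ℕ) (y : Fin (d + m) → ℝ) : Fin d → ℝ := fun i => y (Fin.castAdd m i)

/-- Projection of `ℝⁿ = ℝ^d × ℝ^m` onto the internal space `ℝ^m` (last `m` coordinates). -/
def projInt (d m : ℕ) (y : Fin (d + m) → ℝ) : Fin m → ℝ := fun j => y (Fin.natAdd d j)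

/-- The cut-and-project set `P(W,L) = {π(y) : y ∈ L, π_int(y) ∈ W} ⊂ ℝ^d`. -/
def cutProject (d m : ℕ) (W : Set (Fin m → ℝ)) (L : Set (Fin (d + m) → ℝ)) :
    Set (Fin d → ℝ) :=
  projPhys d m '' {y ∈ L | projInt d m y ∈ W}

/-- A full-rank lattice in `ℝⁿ`: a set of the form `ℤⁿM` with `M ∈ GL(n,ℝ)`
(row vectors, matrices acting on the right). -/
def IsFullLattice {n : ℕ} (L : Set (Fin n → ℝ)) : Prop :=
  ∃ M : Matrix (Fin n) (Fin n) ℝ, IsUnit M.det ∧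
    L = Set.range fun x : Fin n → ℤ => Matrix.vecMul (fun i => (x i : ℝ)) M

/-- An affine lattice in `ℝⁿ`: a translate of a full-rank lattice. -/
def IsAffineLattice {n : ℕ} (L : Set (Fin n → ℝ)) : Prop :=
  ∃ L₀ : Set (Fin n → ℝ), ∃ c : Fin n → ℝ, IsFullLattice L₀ ∧ L = (c + ·) '' L₀

/-- `μ` is a Haar measure of the closed subgroup `A ⊆ ℝ^k`, viewed as a measure on the
ambient space `ℝ^k` giving no mass to the complement of `A`: it is invariant under all
translations by elements of `A`, finite on compact sets, and positive on nonempty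
relatively open subsets of `A`. -/
def IsHaarOn {k : ℕ} (A : Set (Fin k → ℝ)) (μ : Measure (Fin k → ℝ)) : Prop :=
  μ Aᶜ = 0 ∧ (∀ a ∈ A, Measure.map (fun x => a + x) μ = μ) ∧
    (∀ C : Set (Fin k → ℝ), IsCompact C → μ C < ⊤) ∧
    (∀ U : Set (Fin k → ℝ), IsOpen U → (U ∩ A).Nonempty → 0 < μ (U ∩ A))

/-- The frontier (boundary) of `W` relative to the subspace topology of `A`. -/
def relFrontier {k : ℕ} (A W : Set (Fin k → ℝ)) : Set (Fin k → ℝ) :=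
  A ∩ closure W ∩ closure (A \ W)

/-- `W` has nonempty interior relative to the subspace topology of `A`. -/
def RelIntNonempty {k : ℕ} (A W : Set (Fin k → ℝ)) : Prop :=
  ∃ x ∈ W, ∃ U : Set (Fin k → ℝ), IsOpen U ∧ x ∈ U ∧ U ∩ A ⊆ W

/-- `W` is a window for the internal-space closure `A` of the (affine) lattice `L`:
`W ⊆ A` is bounded with nonempty interior relative to `A`; and the window is *regular*
in the sense that its relative boundary is a null set for the Haar measure `μ` of `A`. -/
structure IsRegularWindow (d m : ℕ) (L : Set (Fin (d + m) → ℝ)) (W : Set (Fin m → ℝ))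
    (μ : Measure (Fin m → ℝ)) : Prop where
  subset : W ⊆ closure (projInt d m '' L)
  bounded : IsBounded W
  relInt : RelIntNonempty (closure (projInt d m '' L)) W
  haar : IsHaarOn (closure (projInt d m '' L)) μ
  regular : μ (relFrontier (closure (projInt d m '' L)) W) = 0

/-- The window map `y ↦ π(y)`, `{y ∈ L : π_int(y) ∈ W} → P(W,L)`, is bijective.
(Surjectivity holds by definition; the content is injectivity.) -/
def WindowBijective (d m : ℕ) (L : Set (Fin (d + m) → ℝ)) (W : Set (Fin m → ℝ)) : Prop :=
  Set.InjOn (projPhys d m) {y ∈ L | projInt d m y ∈ W}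

/-- The inclusion `ℝⁿ × ℝ^r → ℝ^{n'}`, `(y,t) ↦ (y,t)`, where `n = d + m` and
`n' = d + (m + r)`. -/
def extEmbed (d m r : ℕ) (y : Fin (d + m) → ℝ) (t : Fin r → ℝ) :
    Fin (d + (m + r)) → ℝ :=
  fun i => Fin.append y t (Fin.cast (add_assoc d m r).symm i)

/-- A full-rank lattice is closed under addition. -/
lemma IsFullLattice.add_mem {n : ℕ} {L : Set (Fin n → ℝ)} (hL : IsFullLattice L)
    {x y : Fin n → ℝ} (hx : x ∈ L) (hy : y ∈ L) : x + y ∈ L := by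
  obtain ⟨M, -, rfl⟩ := hL
  obtain ⟨p, rfl⟩ := hx
  obtain ⟨q, rfl⟩ := hy
  refine ⟨p + q, ?_⟩
  simp only [← Matrix.add_vecMul]
  congr 1
  ext i
  simp

/-- A full-rank lattice is closed under subtraction. -/
lemma IsFullLattice.sub_mem {n : ℕ} {L : Set (Fin n → ℝ)} (hL : IsFullLattice L)
    {x y : Fin n → ℝ} (hx : x ∈ L) (hy : y ∈ L) : x - y ∈ L := by
  obtain ⟨M, -, rfl⟩ := hL
  obtain ⟨p, rfl⟩ := hx
  obtain ⟨q, rfl⟩ := hy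
  refine ⟨p - q, ?_⟩
  simp only [← Matrix.sub_vecMul]
  congr 1
  ext i
  simp

lemma projPhys_add (d m : ℕ) (x y : Fin (d + m) → ℝ) :
    projPhys d m (x + y) = projPhys d m x + projPhys d m y := rfl

lemma projInt_add (d m : ℕ) (x y : Fin (d + m) → ℝ) :
    projInt d m (x + y) = projInt d m x + projInt d m y := rfl

lemma append_add_append {α : Type*} [Add α] {m r : ℕ} (x x' : Fin m → α) (y y' : Fin r → α) :
    Fin.append x y + Fin.append x' y' = Fin.append (x + x') (y + y') := by
  ext i
  induction i using Fin.addCases <;> simp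

lemma append_eq_append_iff {α : Type*} {m r : ℕ} {x x' : Fin m → α} {y y' : Fin r → α} :
    Fin.append x y = Fin.append x' y' ↔ x = x' ∧ y = y' := by
  refine ⟨fun h => ⟨?_, ?_⟩, fun h => by rw [h.1, h.2]⟩
  · ext i
    simpa using congrFun h (Fin.castAdd r i)
  · ext i
    simpa using congrFun h (Fin.natAdd m i)

@[simp] lemma projPhys_extEmbed (d m r : ℕ) (y : Fin (d + m) → ℝ) (t : Fin r → ℝ) :
    projPhys d (m + r) (extEmbed d m r y t) = projPhys d m y := by
  ext i
  exact Fin.append_left y t (Fin.castAdd m i)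

@[simp] lemma projInt_extEmbed (d m r : ℕ) (y : Fin (d + m) → ℝ) (t : Fin r → ℝ) :
    projInt d (m + r) (extEmbed d m r y t) = Fin.append (projInt d m y) t := by
  ext i
  induction i using Fin.addCases with
  | left i =>
    rw [Fin.append_left]
    exact Fin.append_left y t (Fin.natAdd d i)
  | right i =>
    rw [Fin.append_right]
    have h : Fin.cast (add_assoc d m r).symm (Fin.natAdd d (Fin.natAdd m i)) =
        Fin.natAdd (d + m) i := by
      ext
      simp [add_assoc]
    simp only [projInt, extEmbed]
    rw [h, Fin.append_right]

/-- `extEmbed` as a linear map on the product space. -/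
def extEmbedLinear (d m r : ℕ) :
    ((Fin (d + m) → ℝ) × (Fin r → ℝ)) →ₗ[ℝ] (Fin (d + (m + r)) → ℝ) where
  toFun p := extEmbed d m r p.1 p.2
  map_add' p q := by
    ext i
    exact (congrFun (append_add_append p.1 q.1 p.2 q.2) _).symm
  map_smul' c p := by
    ext i
    simp only [extEmbed, Pi.smul_apply]
    induction Fin.cast (add_assoc d m r).symm i using Fin.addCases <;> simp

/-- An element of the extension lattice, written as a single pair. -/
lemma extEmbed_add_sum (d m r : ℕ) (l : Fin (d + m) → ℝ) (b : Fin r → (Fin (d + m) → ℝ))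
    (c : Fin r → ℝ) :
    extEmbed d m r l 0 + ∑ k, c k • extEmbed d m r (b k) (Pi.single k 1) =
      extEmbed d m r (l + ∑ k, c k • b k) c := by
  have h : ((l, 0) : (Fin (d + m) → ℝ) × (Fin r → ℝ)) +
      ∑ k, c k • (b k, (Pi.single k 1 : Fin r → ℝ)) = (l + ∑ k, c k • b k, c) := by
    refine Prod.ext ?_ ?_
    · simp [Prod.fst_sum]
    · simpa [Prod.snd_sum] using (pi_eq_sum_univ' c).symm
  have h' := congrArg (extEmbedLinear d m r) h
  simp only [map_add, map_sum, map_smul] at h'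
  exact h'

/-- The extension of a full-rank lattice by the vectors `(b k, e k)` is a full-rank lattice. -/
lemma IsFullLattice.extension {d m r : ℕ} {L : Set (Fin (d + m) → ℝ)} (hL : IsFullLattice L)
    (b : Fin r → (Fin (d + m) → ℝ)) :
    IsFullLattice {y' | ∃ l ∈ L, ∃ c : Fin r → ℤ,
      y' = extEmbed d m r (l + ∑ k, (c k : ℝ) • b k) (fun k => (c k : ℝ))} := by
  obtain ⟨M, hM, rfl⟩ := hL
  let e : Fin (d + m) ⊕ Fin r ≃ Fin (d + (m + r)) :=
    finSumFinEquiv.trans (finCongr (add_assoc d m r))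
  have hvec (p : Fin (d + m) → ℤ) (c : Fin r → ℤ) (x : Fin (d + (m + r)) → ℤ)
      (hx : x ∘ e = Sum.elim p c) :
      Matrix.vecMul (fun i => (x i : ℝ))
        ((Matrix.fromBlocks M 0 (Matrix.of b) 1).submatrix e.symm e.symm) =
      extEmbed d m r (Matrix.vecMul (fun i => (p i : ℝ)) M + ∑ k, (c k : ℝ) • b k)
        (fun k => (c k : ℝ)) := by
    have hx' : (fun i => (x i : ℝ)) ∘ e =
        Sum.elim (fun i => (p i : ℝ)) (fun k => (c k : ℝ)) := by
      ext i
      have := congrFun hx i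
      cases i <;> simp_all
    rw [Matrix.submatrix_vecMul_equiv, Equiv.symm_symm, hx', Matrix.vecMul_fromBlocks]
    ext i
    obtain ⟨i, rfl⟩ := e.surjective i
    cases i with
    | inl i =>
      simp [e, extEmbed, Matrix.vecMul_eq_sum]
    | inr i => simp [e, extEmbed]
  refine ⟨(Matrix.fromBlocks M 0 (Matrix.of b) 1).submatrix e.symm e.symm, ?_, ?_⟩
  · simpa [Matrix.det_submatrix_equiv_self, Matrix.det_fromBlocks_zero₁₂] using hM
  · ext y
    constructor
    · rintro ⟨-, ⟨p, rfl⟩, c, rfl⟩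
      exact ⟨Sum.elim p c ∘ e.symm, hvec p c _ (by ext i; simp)⟩
    · rintro ⟨x, rfl⟩
      exact ⟨_, ⟨x ∘ e ∘ Sum.inl, rfl⟩, x ∘ e ∘ Sum.inr,
        hvec _ _ x (by ext i; cases i <;> rfl)⟩

/-- A cut-and-project set for a union of windows is the union of the cut-and-project sets. -/
lemma cutProject_iUnion {ι : Type*} (d m : ℕ) (W : ι → Set (Fin m → ℝ))
    (L : Set (Fin (d + m) → ℝ)) :
    cutProject d m (⋃ j, W j) L = ⋃ j, cutProject d m (W j) L := by
  simp only [cutProject, ← Set.image_iUnion]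
  congr 1
  ext y
  simp

/-- **Section 2.3** (Marklof–Strömbergsson, quasicrystal paper): a union of translates
of cut-and-project sets for `L` is itself a cut-and-project set, for the rank-`r`
extension `L' = (L × {0}) + ℤ(b₁,e₁) + ⋯ + ℤ(b_r,e_r)` of `L`. -/
theorem union_translates_cutProject
    (d m r s : ℕ) (hd : 2 ≤ d)
    (L : Set (Fin (d + m) → ℝ)) (hL : IsFullLattice L)
    (W : Fin s → Set (Fin m → ℝ)) (t : Fin s → (Fin d → ℝ))
    (b : Fin r → (Fin (d + m) → ℝ))
    -- each `t_j` lies in `π(L + ℤb₁ + ⋯ + ℤb_r)`; the data `v^{(j)}, α^{(j)}` realize this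
    (v : Fin s → (Fin (d + m) → ℝ)) (hv : ∀ j, v j ∈ L)
    (α : Fin s → Fin r → ℤ)
    (ht : ∀ j, t j = projPhys d m (v j + ∑ k : Fin r, (α j k : ℝ) • b k))
    -- the extension lattice `L' ⊂ ℝ^{n'}`
    (L' : Set (Fin (d + (m + r)) → ℝ))
    (hL' : L' = {y' | ∃ l ∈ L, ∃ c : Fin r → ℤ,
      y' = extEmbed d m r l 0 +
        ∑ k : Fin r, (c k : ℝ) • extEmbed d m r (b k) (Pi.single k 1)})
    -- the vectors `m'_j ∈ L'` and the translated windows `W'_j ⊂ ℝ^{m+r}`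
    (m' : Fin s → (Fin (d + (m + r)) → ℝ))
    (hm' : ∀ j, m' j = extEmbed d m r (v j) 0 +
      ∑ k : Fin r, (α j k : ℝ) • extEmbed d m r (b k) (Pi.single k 1))
    (W' : Fin s → Set (Fin (m + r) → ℝ))
    (hW' : ∀ j, W' j =
      {w | ∃ u ∈ W j, w = Fin.append u 0 + projInt d (m + r) (m' j)}) :
    IsFullLattice L' ∧
    (∀ j : Fin s,
      (fun p => t j + p) '' cutProject d m (W j) L = cutProject d (m + r) (W' j) L') ∧
    (⋃ j : Fin s, (fun p => t j + p) '' cutProject d m (W j) L) =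
      cutProject d (m + r) (⋃ j : Fin s, W' j) L' := by
  simp only [extEmbed_add_sum] at hL' hm'
  have key : ∀ j : Fin s,
      (fun p => t j + p) '' cutProject d m (W j) L = cutProject d (m + r) (W' j) L' := by
    intro j
    rw [hL', hW' j, hm' j, ht j]
    simp only [projInt_extEmbed, append_add_append, zero_add]
    ext p
    constructor
    · rintro ⟨-, ⟨y, ⟨hy, hyW⟩, rfl⟩, rfl⟩
      refine ⟨_, ⟨⟨y + v j, hL.add_mem hy (hv j), α j, rfl⟩, projInt d m y, hyW, ?_⟩, ?_⟩
      · rw [projInt_extEmbed, ← projInt_add, add_assoc]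
      · simp only [projPhys_extEmbed, projPhys_add]
        abel
    · rintro ⟨-, ⟨⟨l, hl, c, rfl⟩, u, hu, h⟩, rfl⟩
      rw [projInt_extEmbed, append_eq_append_iff] at h
      obtain ⟨hu', hc⟩ := h
      obtain rfl : c = α j := by
        ext k
        exact_mod_cast congrFun hc k
      obtain ⟨y, rfl⟩ : ∃ y, l = y + v j := ⟨l - v j, by abel⟩
      have hy : y ∈ L := by simpa using hL.sub_mem hl (hv j)
      rw [add_assoc, projInt_add, add_left_inj] at hu'
      refine ⟨_, ⟨y, ⟨hy, hu' ▸ hu⟩, rfl⟩, ?_⟩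
      simp only [projPhys_extEmbed, projPhys_add]
      abel
  refine ⟨hL' ▸ hL.extension b, key, ?_⟩
  rw [cutProject_iUnion]
  exact Set.iUnion_congr key
end

section
/- Let d ≥ 2 and r ≥ 1 be integers and let β be a real r×d matrix such that there is no κ ∈ ℤ^r ∖ {0} with κβ ∈ ℤ^d (κ a row vector). Then the set {βγ : γ ∈ SL(d,ℤ)}, reduced modulo the subgroup M_{r×d}(ℤ) of integer matrices, is dense in the torus M_{r×d}(ℝ)/M_{r×d}(ℤ). Equivalently: for every v ∈ M_{r×d}(ℝ) and every ε > 0 there exist γ ∈ SL(d,ℤ) and μ ∈ M_{r×d}(ℤ) such that every entry of βγ − v − μ has absolute value less than ε. -/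
namespace UnitAddTorus

open MeasureTheory Filter Topology

section Pairing

variable {ι : Type*} [Fintype ι]

/-- The homomorphism `x ↦ ∑ i, κ i • x i` from the torus to the circle. -/
def pairing (κ : ι → ℤ) : UnitAddTorus ι →+ UnitAddCircle where
  toFun x := ∑ i, κ i • x i
  map_zero' := by simp
  map_add' x y := by simp [Finset.sum_add_distrib]

lemma pairing_apply (κ : ι → ℤ) (x : UnitAddTorus ι) : pairing κ x = ∑ i, κ i • x i := rfl

lemma continuous_pairing (κ : ι → ℤ) : Continuous (pairing κ) := by
  simp only [pairing, AddMonoidHom.coe_mk, ZeroHom.coe_mk]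
  fun_prop

lemma pairing_nsmul_left (n : ℕ) (κ : ι → ℤ) (x : UnitAddTorus ι) :
    pairing (n • κ) x = n • pairing κ x := by
  simp [pairing_apply, Finset.smul_sum, mul_smul]

lemma mFourier_eq_toCircle_pairing (κ : ι → ℤ) (x : UnitAddTorus ι) :
    mFourier κ x = (AddCircle.toCircle (pairing κ x) : ℂ) := by
  have h : ∀ s : Finset ι, ∏ i ∈ s, (fourier (κ i) (x i) : ℂ) =
      (AddCircle.toCircle (∑ i ∈ s, κ i • x i) : ℂ) := by
    classical
    intro s
    induction s using Finset.induction_on with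
    | empty => simp
    | insert i s hi ih =>
      rw [Finset.prod_insert hi, Finset.sum_insert hi, ih, AddCircle.toCircle_add, Circle.coe_mul,
        fourier_apply]
  exact h Finset.univ

lemma mFourier_apply_add (κ : ι → ℤ) (x y : UnitAddTorus ι) :
    mFourier κ (x + y) = mFourier κ x * mFourier κ y := by
  simp [mFourier_eq_toCircle_pairing, AddCircle.toCircle_add]

lemma mFourier_apply_nsmul (κ : ι → ℤ) (n : ℕ) (x : UnitAddTorus ι) :
    mFourier κ (n • x) = mFourier κ x ^ n := by
  simp [mFourier_eq_toCircle_pairing, AddCircle.toCircle_nsmul]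

lemma mFourier_apply_eq_one_iff (κ : ι → ℤ) (x : UnitAddTorus ι) :
    mFourier κ x = 1 ↔ pairing κ x = 0 := by
  rw [mFourier_eq_toCircle_pairing, ← (AddCircle.injective_toCircle one_ne_zero).eq_iff,
    AddCircle.toCircle_zero, Circle.coe_eq_one]

lemma norm_mFourier_apply (κ : ι → ℤ) (x : UnitAddTorus ι) : ‖mFourier κ x‖ = 1 := by
  rw [mFourier_eq_toCircle_pairing, Circle.norm_coe]

/-- The complement of the kernel of a nontrivial character is dense. -/
lemma dense_pairing_ne_zero {κ : ι → ℤ} (hκ : κ ≠ 0) : Dense {x | pairing κ x ≠ 0} := by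
  classical
  intro x
  by_cases hx : pairing κ x = 0
  swap
  · exact subset_closure hx
  obtain ⟨i, hi⟩ := Function.ne_iff.mp hκ
  have hpos : 0 < |(κ i : ℝ)| := by simpa using hi
  have hlim : Tendsto (fun t : ℝ => x + Pi.single i (t : UnitAddCircle)) (𝓝[>] 0) (𝓝 x) := by
    have hc : Continuous (fun t : ℝ => x + Pi.single i (t : UnitAddCircle)) :=
      continuous_const.add ((continuous_single i).comp (AddCircle.continuous_mk' 1))
    simpa using (hc.tendsto 0).mono_left nhdsWithin_le_nhds
  refine mem_closure_of_tendsto hlim ?_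
  filter_upwards [Ioo_mem_nhdsGT (inv_pos.mpr hpos)] with t ht
  have hval : pairing κ (Pi.single i (t : UnitAddCircle)) = ((κ i * t : ℝ) : UnitAddCircle) := by
    rw [pairing_apply, Finset.sum_eq_single i]
    · rw [Pi.single_eq_same, ← AddCircle.coe_zsmul, zsmul_eq_mul]
    · intro j _ hj
      simp [hj]
    · simp
  change pairing κ (x + Pi.single i (t : UnitAddCircle)) ≠ 0
  rw [map_add, hx, zero_add, hval, Ne, AddCircle.coe_eq_zero_iff]
  rintro ⟨n, hn⟩
  have habs : |(n : ℝ)| = |(κ i : ℝ)| * t := by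
    rw [← abs_of_pos ht.1, ← abs_mul, ← hn]; simp
  have h1 : |(n : ℝ)| < 1 := by
    rw [habs]
    calc _ < |(κ i : ℝ)| * |(κ i : ℝ)|⁻¹ := by gcongr; exact ht.2
      _ = 1 := mul_inv_cancel₀ hpos.ne'
  have h2 : 0 < |(n : ℝ)| := by rw [habs]; exact mul_pos hpos ht.1
  have h3 : |n| < 1 := by exact_mod_cast h1
  have h4 : 0 < |n| := by exact_mod_cast h2
  lia

/-- The points of the torus on which no character in `F` vanishes. -/
def avoiding (F : Finset (ι → ℤ)) : Set (UnitAddTorus ι) := {x | ∀ κ ∈ F, pairing κ x ≠ 0}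

lemma avoiding_eq_biInter (F : Finset (ι → ℤ)) :
    avoiding F = ⋂ κ ∈ (F : Set (ι → ℤ)), {x | pairing κ x ≠ 0} := by
  ext; simp [avoiding]

lemma isOpen_avoiding (F : Finset (ι → ℤ)) : IsOpen (avoiding F) := by
  rw [avoiding_eq_biInter]
  exact F.finite_toSet.isOpen_biInter fun κ _ => isOpen_ne.preimage (continuous_pairing κ)

lemma dense_avoiding {F : Finset (ι → ℤ)} (hF : 0 ∉ F) : Dense (avoiding F) := by
  rw [avoiding_eq_biInter]
  exact dense_biInter_of_isOpen (fun κ _ => isOpen_ne.preimage (continuous_pairing κ))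
    F.countable_toSet fun κ hκ => dense_pairing_ne_zero fun h => hF (h ▸ hκ)

lemma volume_real_univ : (volume : Measure (UnitAddTorus ι)).real Set.univ = 1 := by
  simp [Measure.real, volume_pi, Measure.pi_univ]

lemma integral_mFourier {κ : ι → ℤ} (hκ : κ ≠ 0) : ∫ x : UnitAddTorus ι, mFourier κ x = 0 := by
  obtain ⟨t, ht⟩ := (dense_pairing_ne_zero hκ).nonempty
  have h := integral_add_right_eq_self (μ := (volume : Measure (UnitAddTorus ι)))
    (fun x => mFourier κ x) t
  simp only [mFourier_apply_add] at h
  rw [integral_mul_const] at h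
  by_contra hne
  exact ht ((mFourier_apply_eq_one_iff κ t).mp (mul_left_cancel₀ hne (by rw [h, mul_one])))

/-- The averages of the powers of a complex number `z ≠ 1` of norm one tend to zero. -/
lemma _root_.Complex.tendsto_avg_pow {z : ℂ} (hz : ‖z‖ = 1) (hz1 : z ≠ 1) :
    Tendsto (fun K : ℕ => (K : ℂ)⁻¹ * ∑ k ∈ Finset.range K, z ^ k) atTop (𝓝 0) := by
  refine squeeze_zero_norm (a := fun K : ℕ => (K : ℝ)⁻¹ * (2 / ‖z - 1‖)) (fun K => ?_) ?_
  · rw [geom_sum_eq hz1, norm_mul, norm_div, norm_inv, Complex.norm_natCast]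
    gcongr
    calc ‖z ^ K - 1‖ ≤ ‖z ^ K‖ + ‖(1 : ℂ)‖ := norm_sub_le _ _
      _ = 2 := by rw [norm_pow, hz]; norm_num
  · simpa using (tendsto_inv_atTop_nhds_zero_nat (𝕜 := ℝ)).mul_const (2 / ‖z - 1‖)

/-- Orbit averages of a trigonometric polynomial along a translation of the torus converge to its
mean, as soon as the translation avoids finitely many characters. -/
lemma exists_tendsto_avg_of_mem_span {p : C(UnitAddTorus ι, ℂ)}
    (hp : p ∈ Submodule.span ℂ (Set.range (mFourier (d := ι)))) :
    ∃ F : Finset (ι → ℤ), 0 ∉ F ∧ ∀ x ∈ avoiding F, ∀ y,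
      Tendsto (fun K : ℕ => (K : ℂ)⁻¹ * ∑ k ∈ Finset.range K, p (y + k • x)) atTop
        (𝓝 (∫ t, p t)) := by
  classical
  induction hp using Submodule.span_induction with
  | mem p hp =>
    obtain ⟨κ, rfl⟩ := hp
    by_cases hκ : κ = 0
    · refine ⟨∅, by simp, fun x _ y => ?_⟩
      subst hκ
      refine tendsto_const_nhds.congr' ?_
      filter_upwards [eventually_ne_atTop 0] with K hK
      simp [mFourier_zero, hK, volume_real_univ]
    · refine ⟨{κ}, by simpa using Ne.symm hκ, fun x hx y => ?_⟩
      have hx1 : mFourier κ x ≠ 1 := by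
        rw [Ne, mFourier_apply_eq_one_iff]
        exact hx κ (by simp)
      have h := (Complex.tendsto_avg_pow (norm_mFourier_apply κ x) hx1).const_mul (mFourier κ y)
      rw [integral_mFourier hκ]
      simp only [mFourier_apply_add, mFourier_apply_nsmul, ← Finset.mul_sum]
      simpa [mul_left_comm] using h
  | zero => exact ⟨∅, by simp, fun x _ y => by simp⟩
  | add p q _ _ hp hq =>
    obtain ⟨F, hF, hp⟩ := hp
    obtain ⟨G, hG, hq⟩ := hq
    refine ⟨F ∪ G, by simp [hF, hG], fun x hx y => ?_⟩
    have h := (hp x (fun κ hκ => hx κ (Finset.mem_union_left _ hκ)) y).add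
      (hq x (fun κ hκ => hx κ (Finset.mem_union_right _ hκ)) y)
    simp only [ContinuousMap.add_apply]
    rw [integral_add (p.continuous.integrable_of_hasCompactSupport (.of_compactSpace _))
      (q.continuous.integrable_of_hasCompactSupport (.of_compactSpace _))]
    simpa only [Finset.sum_add_distrib, mul_add] using h
  | smul c p _ hp =>
    obtain ⟨F, hF, hp⟩ := hp
    refine ⟨F, hF, fun x hx y => ?_⟩
    simp only [ContinuousMap.smul_apply, smul_eq_mul, integral_const_mul, ← Finset.mul_sum]
    simpa [mul_left_comm] using (hp x hx y).const_mul c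

/-- **Quantitative Kronecker theorem**: for each nonempty open subset `U` of the torus there are
finitely many nontrivial characters such that every orbit of every translation avoiding these
characters meets `U`. -/
theorem exists_forall_avoiding_exists_add_nsmul_mem {U : Set (UnitAddTorus ι)} (hU : IsOpen U)
    (hne : U.Nonempty) :
    ∃ F : Finset (ι → ℤ), 0 ∉ F ∧ ∀ x ∈ avoiding F, ∀ y, ∃ k : ℕ, y + k • x ∈ U := by
  obtain ⟨u, hu⟩ := hne
  obtain ⟨g, hg0, hg1, hg⟩ := exists_continuous_zero_one_of_isClosed hU.isClosed_compl
    (isClosed_singleton (x := u)) (by simpa using hu)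
  have hint : Integrable g := g.continuous.integrable_of_hasCompactSupport (.of_compactSpace _)
  have hc : 0 < ∫ t, g t := by
    refine integral_pos_of_integrable_nonneg_nonzero (x := u) g.continuous hint
      (fun t => (hg t).1) ?_
    simp [hg1 rfl]
  set c := ∫ t, g t with hc_def
  let G : C(UnitAddTorus ι, ℂ) := ⟨fun t => (g t : ℂ), by fun_prop⟩
  have hG : G ∈ (Submodule.span ℂ (Set.range (mFourier (d := ι)))).topologicalClosure := by
    rw [span_mFourier_closure_eq_top]; trivial
  obtain ⟨p, hp, hpG⟩ := Metric.mem_closure_iff.mp hG (c / 3) (by positivity)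
  have hdist : ∀ t, ‖G t - p t‖ < c / 3 := fun t => by
    rw [← dist_eq_norm]
    exact (ContinuousMap.dist_apply_le_dist t).trans_lt hpG
  obtain ⟨F, hF, h⟩ := exists_tendsto_avg_of_mem_span hp
  refine ⟨F, hF, fun x hx y => ?_⟩
  by_contra! hmiss
  have hsmall : ‖∫ t, p t‖ ≤ c / 3 := by
    refine le_of_tendsto (h x hx y).norm ?_
    filter_upwards [eventually_gt_atTop 0] with K hK
    have hK' : (0 : ℝ) < K := by exact_mod_cast hK
    rw [norm_mul, norm_inv, Complex.norm_natCast, inv_mul_le_iff₀ hK']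
    refine (norm_sum_le_of_le _ (f := fun k => p (y + k • x)) (n := fun _ => c / 3)
      fun k _ => ?_).trans (by simp)
    have hk := hdist (y + k • x)
    have hz : G (y + k • x) = 0 := by
      simpa [G] using hg0 (show y + k • x ∈ Uᶜ from hmiss k)
    rw [hz, zero_sub, norm_neg] at hk
    exact hk.le
  have hGint : ∫ t, G t = (c : ℂ) := by
    rw [hc_def, ← integral_complex_ofReal]; rfl
  have hclose : ‖∫ t, (G t - p t)‖ ≤ c / 3 := by
    simpa [volume_real_univ] using norm_integral_le_of_norm_le_const
      (μ := (volume : Measure (UnitAddTorus ι))) (.of_forall fun t => (hdist t).le)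
  rw [integral_sub (G.continuous.integrable_of_hasCompactSupport (.of_compactSpace _))
      (p.continuous.integrable_of_hasCompactSupport (.of_compactSpace _)), hGint] at hclose
  have htri := norm_le_norm_sub_add (c : ℂ) (∫ t, p t)
  rw [Complex.norm_real, Real.norm_of_nonneg hc.le] at htri
  linarith

end Pairing

end UnitAddTorus

open scoped Pointwise in
/-- Finitely many affine maps on an abelian group, none of which is torsion, are simultaneously
nonvanishing at some point. -/
lemma AddMonoidHom.exists_forall_add_apply_ne_zero {A B I : Type*} [AddCommGroup A]
    [AddCommGroup B] (F : Finset I) (φ : I → A →+ B) (b : I → B)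
    (h : ∀ i ∈ F, ∀ n : ℕ, n ≠ 0 → n • φ i = 0 → n • b i ≠ 0) :
    ∃ a, ∀ i ∈ F, b i + φ i a ≠ 0 := by
  classical
  by_contra! hcover
  let F' := {i ∈ F | ∃ a, b i + φ i a = 0}
  have hF' : ∀ i : I, ∃ a, i ∈ F' → b i + φ i a = 0 := fun i => by
    by_cases hi : i ∈ F'
    · obtain ⟨a, ha⟩ := (Finset.mem_filter.mp hi).2
      exact ⟨a, fun _ => ha⟩
    · exact ⟨0, fun h => absurd h hi⟩
  choose g hg using hF'
  have hcovers : ⋃ i ∈ F', g i +ᵥ ((φ i).ker : Set A) = Set.univ := by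
    refine Set.eq_univ_of_forall fun a => ?_
    obtain ⟨i, hi, ha⟩ := hcover a
    have hi' : i ∈ F' := Finset.mem_filter.mpr ⟨hi, a, ha⟩
    refine Set.mem_biUnion hi' ?_
    rw [mem_leftAddCoset_iff, SetLike.mem_coe, AddMonoidHom.mem_ker, map_add, map_neg,
      neg_add_eq_zero]
    exact add_left_cancel ((hg i hi').trans ha.symm)
  obtain ⟨i, hi, hfin⟩ := AddSubgroup.exists_finiteIndex_of_leftCoset_cover hcovers
  have hker : ∀ a, (φ i).ker.index • φ i a = 0 := fun a => by
    rw [← map_nsmul]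
    exact (φ i).ker.nsmul_index_mem a
  refine h i (Finset.mem_filter.mp hi).1 _ hfin.index_ne_zero (AddMonoidHom.ext hker) ?_
  rw [eq_neg_of_add_eq_zero_left (hg i hi), smul_neg, hker, neg_zero]

namespace Matrix.SpecialLinearGroup

variable {n : Type*} [Fintype n] [DecidableEq n]

/-- The right action of an integer matrix on tuples can first be precomposed with a shear. -/
lemma exists_sum_smul_mem_of_shear {A : Type*} [AddCommGroup A] {V : n → Set A} (c : n → A)
    (u v : n → ℤ) (huv : v ⬝ᵥ u = 0)
    (h : ∃ γ : SpecialLinearGroup n ℤ, ∀ j,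
      ∑ i, (γ : Matrix n n ℤ) i j • (c i + v i • ∑ l, u l • c l) ∈ V j) :
    ∃ γ : SpecialLinearGroup n ℤ, ∀ j, ∑ i, (γ : Matrix n n ℤ) i j • c i ∈ V j := by
  obtain ⟨γ, hγ⟩ := h
  let S : SpecialLinearGroup n ℤ := ⟨1 + vecMulVec u v, by
    rw [vecMulVec_eq Unit, det_one_add_replicateCol_mul_replicateRow, huv, add_zero]⟩
  refine ⟨S * γ, fun j => ?_⟩
  convert hγ j using 1
  have hS : ∀ i l, (S : Matrix n n ℤ) i l = (1 : Matrix n n ℤ) i l + u i * v l := fun i l => rfl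
  simp only [coe_mul, mul_apply, hS, add_mul, Finset.sum_add_distrib, add_smul, smul_add,
    Finset.smul_sum, Finset.sum_smul, smul_smul]
  congr 1
  · simp [one_apply]
  · rw [Finset.sum_comm]
    exact Finset.sum_congr rfl fun i _ => Finset.sum_congr rfl fun l _ => by congr 1; ring

end Matrix.SpecialLinearGroup

namespace UnitAddTorus

open Matrix

variable {ι n : Type*} [Fintype ι] [Fintype n] [DecidableEq n]

/-- If no nontrivial character of the torus vanishes on all entries of a tuple, then the orbit of
the tuple under the special linear group over `ℤ` is dense. -/
theorem exists_sum_smul_mem_of_isOpen {a b : n} (hab : a ≠ b) (c : n → UnitAddTorus ι)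
    (hc : ∀ κ : ι → ℤ, κ ≠ 0 → ∃ j, pairing κ (c j) ≠ 0) {V : n → Set (UnitAddTorus ι)}
    (hV : ∀ j, IsOpen (V j)) (hne : ∀ j, (V j).Nonempty) :
    ∃ γ : SpecialLinearGroup n ℤ, ∀ j, ∑ i, (γ : Matrix n n ℤ) i j • c i ∈ V j := by
  classical
  choose F hF0 hF using fun j => exists_forall_avoiding_exists_add_nsmul_mem (hV j) (hne j)
  have hF0' : 0 ∉ Finset.univ.biUnion F := by simpa using hF0
  obtain ⟨G, hG0, hG⟩ := exists_forall_avoiding_exists_add_nsmul_mem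
    ((hV a).inter (isOpen_avoiding (Finset.univ.biUnion F)))
    ((dense_avoiding hF0').inter_open_nonempty _ (hV a) (hne a))
  obtain ⟨H, hH0, hH⟩ := exists_forall_avoiding_exists_add_nsmul_mem (isOpen_avoiding G)
    (dense_avoiding hG0).nonempty
  have of_mem_inter : ∀ c : n → UnitAddTorus ι, c a ∈ V a ∩ avoiding (Finset.univ.biUnion F) →
      ∃ γ : SpecialLinearGroup n ℤ, ∀ j, ∑ i, (γ : Matrix n n ℤ) i j • c i ∈ V j := by
    rintro c ⟨hca, hcF⟩
    choose k hk using fun j => hF j (c a)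
      (fun κ hκ => hcF κ (Finset.mem_biUnion.mpr ⟨j, Finset.mem_univ j, hκ⟩)) (c j)
    refine SpecialLinearGroup.exists_sum_smul_mem_of_shear c (Pi.single a 1)
      (Function.update (fun j => (k j : ℤ)) a 0) (by simp) ⟨1, fun j => ?_⟩
    by_cases hj : j = a
    · subst hj
      simpa [one_apply, Pi.single_apply, Finset.sum_add_distrib] using hca
    · simpa [one_apply, Pi.single_apply, Finset.sum_add_distrib, hj] using hk j
  have of_avoiding_right : ∀ c : n → UnitAddTorus ι, c b ∈ avoiding G →
      ∃ γ : SpecialLinearGroup n ℤ, ∀ j, ∑ i, (γ : Matrix n n ℤ) i j • c i ∈ V j := by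
    intro c hcb
    obtain ⟨k, hk⟩ := hG (c b) hcb (c a)
    refine SpecialLinearGroup.exists_sum_smul_mem_of_shear c (Pi.single b 1)
      (Pi.single a (k : ℤ)) (by simp [hab.symm]) (of_mem_inter _ ?_)
    simpa [Pi.single_apply] using hk
  have of_avoiding_left : ∀ c : n → UnitAddTorus ι, c a ∈ avoiding H →
      ∃ γ : SpecialLinearGroup n ℤ, ∀ j, ∑ i, (γ : Matrix n n ℤ) i j • c i ∈ V j := by
    intro c hca
    obtain ⟨k, hk⟩ := hH (c a) hca (c b)
    refine SpecialLinearGroup.exists_sum_smul_mem_of_shear c (Pi.single a 1)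
      (Pi.single b (k : ℤ)) (by simp [hab]) (of_avoiding_right _ ?_)
    simpa [Pi.single_apply] using hk
  let ψ : (n → ℤ) →+ UnitAddTorus ι :=
    { toFun u := ∑ i, Function.update u a 0 i • c i
      map_zero' := by simp
      map_add' u v := by
        rw [← Finset.sum_add_distrib]
        refine Finset.sum_congr rfl fun i _ => ?_
        by_cases hi : i = a <;> simp [hi, add_smul] }
  obtain ⟨u, hu⟩ := AddMonoidHom.exists_forall_add_apply_ne_zero H
    (fun κ => (pairing κ).comp ψ) (fun κ => pairing κ (c a)) (by
      intro κ hκ m hm hψ ha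
      have hκ0 : κ ≠ 0 := fun h => hH0 (h ▸ hκ)
      obtain ⟨j, hj⟩ := hc (m • κ) (smul_ne_zero hm hκ0)
      rw [pairing_nsmul_left] at hj
      by_cases hja : j = a
      · exact hj (hja ▸ ha)
      · refine hj ?_
        have hψj : ψ (Pi.single j 1 : n → ℤ) = c j := by
          change ∑ i, Function.update (Pi.single j 1 : n → ℤ) a 0 i • c i = c j
          rw [Finset.sum_eq_single j] <;> simp +contextual [Function.update_apply, hja]
        simpa [hψj] using DFunLike.congr_fun hψ (Pi.single j 1 : n → ℤ))
  refine SpecialLinearGroup.exists_sum_smul_mem_of_shear c (Function.update u a 0)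
    (Pi.single a 1) (by simp) (of_avoiding_left _ ?_)
  intro κ hκ
  simpa [ψ] using hu κ hκ

end UnitAddTorus

/-- **Weyl-type density used in Sec. 2.3.2** (Marklof–Strömbergsson, quasicrystal paper).
If no nonzero integer row vector `κ ∈ ℤ^r` satisfies `κβ ∈ ℤ^d`, then the set
`{βγ : γ ∈ SL(d,ℤ)}` is dense in the torus `M_{r×d}(ℝ)/M_{r×d}(ℤ)`: for every
`v ∈ M_{r×d}(ℝ)` and `ε > 0` there are `γ ∈ SL(d,ℤ)` and `μ ∈ M_{r×d}(ℤ)` with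
every entry of `βγ − v − μ` of absolute value less than `ε`. -/
theorem dense_beta_SLZ_orbit_mod_int
    (d r : ℕ) (hd : 2 ≤ d) (hr : 1 ≤ r)
    (β : Matrix (Fin r) (Fin d) ℝ)
    (hβ : ∀ κ : Fin r → ℤ, κ ≠ 0 → ∀ z : Fin d → ℤ,
      Matrix.vecMul (fun i => (κ i : ℝ)) β ≠ fun j => (z j : ℝ)) :
    ∀ v : Matrix (Fin r) (Fin d) ℝ, ∀ ε > (0 : ℝ),
      ∃ γ : Matrix.SpecialLinearGroup (Fin d) ℤ, ∃ μ : Matrix (Fin r) (Fin d) ℤ,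
        ∀ i j, |(β * ((γ : Matrix (Fin d) (Fin d) ℤ).map (fun z : ℤ => (z : ℝ)))) i j
          - v i j - (μ i j : ℝ)| < ε := by
  intro v ε hε
  let c : Fin d → UnitAddTorus (Fin r) := fun j i => (β i j : UnitAddCircle)
  have hc : ∀ κ : Fin r → ℤ, κ ≠ 0 → ∃ j, UnitAddTorus.pairing κ (c j) ≠ 0 := by
    intro κ hκ
    by_contra! h
    have hz : ∀ j, ∃ z : ℤ, ∑ i, (κ i : ℝ) * β i j = z := fun j => by
      have hj : ((∑ i, (κ i : ℝ) * β i j : ℝ) : UnitAddCircle) = 0 := by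
        rw [← h j, UnitAddTorus.pairing_apply]
        simp only [c, ← AddCircle.coe_zsmul, zsmul_eq_mul]
        exact map_sum (QuotientAddGroup.mk' (AddSubgroup.zmultiples (1 : ℝ))) _ _
      obtain ⟨z, hz⟩ := AddCircle.coe_eq_zero_iff (1 : ℝ) |>.mp hj
      exact ⟨z, by simpa using hz.symm⟩
    choose z hz using hz
    exact hβ κ hκ z (funext hz)
  obtain ⟨γ, hγ⟩ := UnitAddTorus.exists_sum_smul_mem_of_isOpen
    (a := ⟨0, by lia⟩) (b := ⟨1, by lia⟩) (Fin.ne_of_val_ne zero_ne_one) c hc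
    (V := fun j => Metric.ball (fun i => (v i j : UnitAddCircle)) ε)
    (fun j => Metric.isOpen_ball) (fun j => Metric.nonempty_ball.mpr hε)
  refine ⟨γ, fun i j => round ((β * (γ : Matrix (Fin d) (Fin d) ℤ).map
    (fun z : ℤ => (z : ℝ))) i j - v i j), fun i j => ?_⟩
  have h := (dist_pi_lt_iff hε).mp (Metric.mem_ball.mp (hγ j)) i
  have hcoe : (∑ l, (γ : Matrix (Fin d) (Fin d) ℤ) l j • c l) i =
      (((β * (γ : Matrix (Fin d) (Fin d) ℤ).map (fun z : ℤ => (z : ℝ))) i j : ℝ) :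
        UnitAddCircle) := by
    rw [Finset.sum_apply, Matrix.mul_apply]
    refine Eq.trans ?_
      (map_sum (QuotientAddGroup.mk' (AddSubgroup.zmultiples (1 : ℝ))) _ _).symm
    refine Finset.sum_congr rfl fun l _ => ?_
    rw [Pi.smul_apply, ← AddCircle.coe_zsmul, zsmul_eq_mul, mul_comm]
    rfl
  rwa [hcoe, dist_eq_norm, ← AddCircle.coe_sub, UnitAddCircle.norm_eq] at h
end

section
/- Let τ = (1+√5)/2 and τ̄ = 1 − τ = (1−√5)/2. Let L' ⊂ ℝ⁵ be the set L' = {(a₁+b₁τ, a₂+b₂τ, a₁+b₁τ̄, a₂+b₂τ̄, k) : a₁,b₁,a₂,b₂,k ∈ ℤ, k ≡ −2(2a₁+b₁+2a₂+b₂) (mod 5)}, and let g₀ ∈ GL(5,ℝ) be √(2/5) times the matrix with rows (1,0,0,0,0), (cos(2π/5), sin(2π/5), 0, 0, 0), (0,0,1,0,0), (0,0,cos(4π/5), sin(4π/5), 0), (0,0,0,0,2^{-1/2}). Then L'g₀ = L, where L'g₀ = {x g₀ : x ∈ L'} (row vectors acting on the right) and L = ℤv₀ + ℤv₁ + ℤv₂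 + ℤv₃ + ℤv₄ is the lattice spanned by the vectors v_j = √(2/5)·(cos(2πj/5), sin(2πj/5), cos(4πj/5), sin(4πj/5), 2^{-1/2}), j = 0,1,2,3,4. -/
open Real

noncomputable section

/-- The golden ratio `τ = (1+√5)/2`. -/
def gold : ℝ := (1 + Real.sqrt 5) / 2

/-- The conjugate `τ̄ = 1 − τ = (1−√5)/2`. -/
def goldConj : ℝ := (1 - Real.sqrt 5) / 2

/-- The lattice `L' ⊂ ℝ⁵`: a rank-one extension of an index-5 sublattice of the
Hilbert modular lattice of `ℚ(√5)`. -/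
def PenroseLp : Set (Fin 5 → ℝ) :=
  {x | ∃ a₁ b₁ a₂ b₂ k : ℤ,
    (5 : ℤ) ∣ (k + 2 * (2 * a₁ + b₁ + 2 * a₂ + b₂)) ∧
    x = ![(a₁ : ℝ) + (b₁ : ℝ) * gold, (a₂ : ℝ) + (b₂ : ℝ) * gold,
          (a₁ : ℝ) + (b₁ : ℝ) * goldConj, (a₂ : ℝ) + (b₂ : ℝ) * goldConj, (k : ℝ)]}

/-- The matrix `g₀ ∈ GL(5,ℝ)`. -/
def Penroseg₀ : Matrix (Fin 5) (Fin 5) ℝ :=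
  Real.sqrt (2 / 5) •
    !![1, 0, 0, 0, 0;
       Real.cos (2 * π / 5), Real.sin (2 * π / 5), 0, 0, 0;
       0, 0, 1, 0, 0;
       0, 0, Real.cos (4 * π / 5), Real.sin (4 * π / 5), 0;
       0, 0, 0, 0, (Real.sqrt 2)⁻¹]

/-- The vectors `v_j`, `j = 0,…,4`, spanning the Penrose quasicrystal lattice `L`. -/
def PenroseV (j : Fin 5) : Fin 5 → ℝ :=
  Real.sqrt (2 / 5) •
    ![Real.cos (2 * π * (j : ℝ) / 5), Real.sin (2 * π * (j : ℝ) / 5),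
      Real.cos (4 * π * (j : ℝ) / 5), Real.sin (4 * π * (j : ℝ) / 5), (Real.sqrt 2)⁻¹]

/-- The lattice `L = ℤv₀ + ℤv₁ + ℤv₂ + ℤv₃ + ℤv₄` of the Penrose tiling. -/
def PenroseL : Set (Fin 5 → ℝ) :=
  {x | ∃ c : Fin 5 → ℤ, x = ∑ j : Fin 5, (c j : ℝ) • PenroseV j}

end

theorem two_mul_cos_two_pi_div_five : 2 * cos (2 * π / 5) = gold - 1 := by
  have h5 : √5 ^ 2 = 5 := Real.sq_sqrt (by norm_num)
  rw [show 2 * π / 5 = 2 * (π / 5) by ring, cos_two_mul, cos_pi_div_five, gold]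
  linear_combination h5 / 4

theorem two_mul_cos_four_pi_div_five : 2 * cos (4 * π / 5) = goldConj - 1 := by
  rw [show 4 * π / 5 = π - π / 5 by ring, cos_pi_sub, cos_pi_div_five, goldConj]
  ring

theorem gold_sq : gold ^ 2 = gold + 1 := by
  have h5 : √5 ^ 2 = 5 := Real.sq_sqrt (by norm_num)
  rw [gold]
  linear_combination h5 / 4

theorem goldConj_sq : goldConj ^ 2 = goldConj + 1 := by
  have h5 : √5 ^ 2 = 5 := Real.sq_sqrt (by norm_num)
  rw [goldConj]
  linear_combination h5 / 4

/-- If `ζ = exp (iθ)` and `g = 1 + 2 cos θ` satisfies `g² = g + 1`, then `ζ` is a primitive fifth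
root of unity; these are the real and imaginary parts of `ζ²`, `ζ³`, `ζ⁴` in the basis `1, ζ`. -/
theorem cos_sin_multiples {θ g : ℝ} (hθ : 2 * cos θ = g - 1) (hg : g ^ 2 = g + 1) :
    (cos (2 * θ) = -1 + (g - 1) * cos θ ∧ sin (2 * θ) = (g - 1) * sin θ) ∧
    (cos (3 * θ) = (1 - g) + (1 - g) * cos θ ∧ sin (3 * θ) = (1 - g) * sin θ) ∧
    (cos (4 * θ) = (g - 1) - cos θ ∧ sin (4 * θ) = -sin θ) := by
  have c2 : cos (2 * θ) = -1 + (g - 1) * cos θ := by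
    rw [cos_two_mul]
    linear_combination cos θ * hθ
  have s2 : sin (2 * θ) = (g - 1) * sin θ := by
    rw [sin_two_mul]
    linear_combination sin θ * hθ
  have step_cos (x : ℝ) : cos (x + 2 * θ) = (g - 1) * cos (x + θ) - cos x := by
    have h := cos_add_cos (x + 2 * θ) x
    rw [show (x + 2 * θ + x) / 2 = x + θ by ring, show (x + 2 * θ - x) / 2 = θ by ring] at h
    linear_combination h + cos (x + θ) * hθ
  have step_sin (x : ℝ) : sin (x + 2 * θ) = (g - 1) * sin (x + θ) - sin x := by
    have h := sin_add_sin (x + 2 * θ) x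
    rw [show (x + 2 * θ + x) / 2 = x + θ by ring, show (x + 2 * θ - x) / 2 = θ by ring] at h
    linear_combination h + sin (x + θ) * hθ
  have c3 : cos (3 * θ) = (1 - g) + (1 - g) * cos θ := by
    have h := step_cos θ
    rw [show θ + 2 * θ = 3 * θ by ring, show θ + θ = 2 * θ by ring, c2] at h
    linear_combination h + cos θ * hg
  have s3 : sin (3 * θ) = (1 - g) * sin θ := by
    have h := step_sin θ
    rw [show θ + 2 * θ = 3 * θ by ring, show θ + θ = 2 * θ by ring, s2] at h
    linear_combination h + sin θ * hg
  refine ⟨⟨c2, s2⟩, ⟨c3, s3⟩, ?_, ?_⟩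
  · have h := step_cos (2 * θ)
    rw [show 2 * θ + 2 * θ = 4 * θ by ring, show 2 * θ + θ = 3 * θ by ring, c2, c3] at h
    linear_combination h - (1 + cos θ) * hg
  · have h := step_sin (2 * θ)
    rw [show 2 * θ + 2 * θ = 4 * θ by ring, show 2 * θ + θ = 3 * θ by ring, s2, s3] at h
    linear_combination h - sin θ * hg

/-- The preimages of the vectors `v_j` under `g₀`: the powers of a primitive fifth root of unity
`ζ` in the basis `1, ζ`, their conjugates, and a last coordinate `1`. -/
noncomputable def penroseW : Fin 5 → Fin 5 → ℝ :=
  ![![1, 0, 1, 0, 1],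
    ![0, 1, 0, 1, 1],
    ![-1, gold - 1, -1, goldConj - 1, 1],
    ![1 - gold, 1 - gold, 1 - goldConj, 1 - goldConj, 1],
    ![gold - 1, -1, goldConj - 1, -1, 1]]

theorem vecMul_Penroseg₀ (x : Fin 5 → ℝ) :
    Matrix.vecMul x Penroseg₀ = √(2 / 5) •
      ![x 0 + x 1 * cos (2 * π / 5), x 1 * sin (2 * π / 5),
        x 2 + x 3 * cos (4 * π / 5), x 3 * sin (4 * π / 5), x 4 * (√2)⁻¹] := by
  rw [Penroseg₀, Matrix.vecMul_smul]
  congr 1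
  ext i
  fin_cases i <;> simp [Matrix.vecMul, dotProduct, Fin.sum_univ_five]

theorem vecMul_penroseW (j : Fin 5) :
    Matrix.vecMul (penroseW j) Penroseg₀ = PenroseV j := by
  obtain ⟨⟨c2, s2⟩, ⟨c3, s3⟩, c4, s4⟩ :=
    cos_sin_multiples two_mul_cos_two_pi_div_five gold_sq
  obtain ⟨⟨c2', s2'⟩, ⟨c3', s3'⟩, c4', s4'⟩ :=
    cos_sin_multiples two_mul_cos_four_pi_div_five goldConj_sq
  have angle (m n : ℝ) : m * π * n / 5 = n * (m * π / 5) := by ring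
  rw [vecMul_Penroseg₀, PenroseV]
  congr 1
  simp only [angle]
  fin_cases j <;>
    simp [penroseW, c2, s2, c3, s3, c4, s4, c2', s2', c3', s3', c4', s4', sub_eq_add_neg]

theorem sum_smul_penroseW (c : Fin 5 → ℤ) :
    ∑ j, (c j : ℝ) • penroseW j =
      ![((c 0 - c 2 + c 3 - c 4 : ℤ) : ℝ) + ((c 4 - c 3 : ℤ) : ℝ) * gold,
        ((c 1 - c 2 + c 3 - c 4 : ℤ) : ℝ) + ((c 2 - c 3 : ℤ) : ℝ) * gold,
        ((c 0 - c 2 + c 3 - c 4 : ℤ) : ℝ) + ((c 4 - c 3 : ℤ) : ℝ) * goldConj,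
        ((c 1 - c 2 + c 3 - c 4 : ℤ) : ℝ) + ((c 2 - c 3 : ℤ) : ℝ) * goldConj,
        ((c 0 + c 1 + c 2 + c 3 + c 4 : ℤ) : ℝ)] := by
  ext i
  fin_cases i <;> simp [penroseW, Fin.sum_univ_five] <;> ring

theorem mem_PenroseLp_iff (x : Fin 5 → ℝ) :
    x ∈ PenroseLp ↔ ∃ c : Fin 5 → ℤ, x = ∑ j, (c j : ℝ) • penroseW j := by
  constructor
  · rintro ⟨a₁, b₁, a₂, b₂, k, hk, rfl⟩
    obtain ⟨t, ht⟩ : (5 : ℤ) ∣ k - a₁ - a₂ - 3 * b₁ - 3 * b₂ := by omega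
    refine ⟨![a₁ + b₁ + b₂ + t, a₂ + b₁ + b₂ + t, b₂ + t, t, b₁ + t], ?_⟩
    obtain rfl : k = 5 * t + a₁ + a₂ + 3 * b₁ + 3 * b₂ := by omega
    rw [sum_smul_penroseW]
    ext i
    fin_cases i <;> simp
    ring
  · rintro ⟨c, rfl⟩
    exact ⟨_, _, _, _, _, by omega, sum_smul_penroseW c⟩

theorem vecMul_sum_smul_penroseW (c : Fin 5 → ℤ) :
    Matrix.vecMul (∑ j, (c j : ℝ) • penroseW j) Penroseg₀ = ∑ j, (c j : ℝ) • PenroseV j := by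
  simp only [Matrix.sum_vecMul, Matrix.smul_vecMul, vecMul_penroseW]

/-- **Identity (2.33)** (Marklof–Strömbergsson, quasicrystal paper): `L'g₀ = L`,
exhibiting the lattice of the Penrose tiling as an image of a rank-one extension of an
index-5 sublattice of the Hilbert modular lattice for `ℚ(√5)`. -/
theorem penrose_lattice_eq :
    (fun x => Matrix.vecMul x Penroseg₀) '' PenroseLp = PenroseL := by
  ext y
  constructor
  · rintro ⟨x, hx, rfl⟩
    obtain ⟨c, rfl⟩ := (mem_PenroseLp_iff x).1 hx
    exact ⟨c, vecMul_sum_smul_penroseW c⟩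
  · rintro ⟨c, rfl⟩
    exact ⟨_, (mem_PenroseLp_iff _).2 ⟨c, rfl⟩, vecMul_sum_smul_penroseW c⟩
end

section
/- Let L ⊂ ℝⁿ be an affine lattice with underlying lattice L₀ = L − L. Let A₀ = closure of π_int(L₀) (a closed subgroup of ℝ^m), A° its identity component (a linear subspace of ℝ^m, of dimension m₁), and V = ℝ^d × A°, so that L₀ ∩ V is a full-rank lattice in V. Let μ₀ be any nonzero translation-invariant Radon (Haar) measure on A₀; fix y₀ ∈ L, set c = π_int(y₀), and let μ be the translate of μ₀ to the coset A = c + A₀ = closure of π_int(L), i.e. μ(E) = μ₀(E − c). Let ν = vol_{ℝ^d} × (μ₀ restricted to A°) on V, and let F ⊂ V be a Borel fundamental domain for the lattice L₀ ∩ V in V (so 0 < ν(F) < ∞). Then for any bounded W ⊂ A with μ(∂W) = 0 (boundary relative to A) and any bounded D ⊂ ℝ^d with vol(∂D) = 0: #{y ∈ L : π(y) ∈ x + T·D, π_int(y) ∈ W} / T^d → vol(D)·μ(W)/ν(F) as T → ∞, uniformly over all x ∈ ℝ^d. -/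
open MeasureTheory Matrix Topology Bornology

/-- The identification `ℝ^d × ℝ^m ≃ ℝⁿ`. -/
def pairEmbed (d m : ℕ) (x : Fin d → ℝ) (z : Fin m → ℝ) : Fin (d + m) → ℝ :=
  Fin.append x z

/-- The product measure `vol_{ℝ^d} × κ`, viewed as a measure on `ℝⁿ = ℝ^d × ℝ^m`. -/
noncomputable def physProdMeasure (d m : ℕ) (κ : MeasureTheory.Measure (Fin m → ℝ)) :
    MeasureTheory.Measure (Fin (d + m) → ℝ) :=
  MeasureTheory.Measure.map (fun p : (Fin d → ℝ) × (Fin m → ℝ) => pairEmbed d m p.1 p.2)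
    ((MeasureTheory.volume : MeasureTheory.Measure (Fin d → ℝ)).prod κ)

open scoped ENNReal

section UniformCounting

open Set Filter Metric

section RelFrontier

variable {k : ℕ} {A W : Set (Fin k → ℝ)} {κ : Measure (Fin k → ℝ)}

theorem measure_closure_eq_of_relFrontier_null (hA : κ Aᶜ = 0) (hr : κ (relFrontier A W) = 0) :
    κ (closure W) = κ W := by
  refine le_antisymm ?_ (measure_mono subset_closure)
  have hsub : closure W ⊆ W ∪ (Aᶜ ∪ relFrontier A W) := by
    intro x hx
    by_cases hW : x ∈ W
    · exact Or.inl hW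
    by_cases hxA : x ∈ A
    · exact Or.inr (Or.inr ⟨⟨hxA, hx⟩, subset_closure ⟨hxA, hW⟩⟩)
    · exact Or.inr (Or.inl hxA)
  calc κ (closure W) ≤ κ W + (κ Aᶜ + κ (relFrontier A W)) :=
        (measure_mono hsub).trans ((measure_union_le _ _).trans
          (by gcongr; exact measure_union_le _ _))
    _ = κ W := by rw [hA, hr]; simp

/-- The inner approximation of `W` relative to `A`: points of `closure W` at distance more than
`δ` from `A \ W`. -/
def innerThinning (A W : Set (Fin k → ℝ)) (δ : ℝ) : Set (Fin k → ℝ) :=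
  closure W \ cthickening δ (A \ W)

theorem measurableSet_innerThinning (δ : ℝ) : MeasurableSet (innerThinning A W δ) :=
  isClosed_closure.measurableSet.diff isClosed_cthickening.measurableSet

theorem mem_of_dist_le_of_mem_innerThinning {δ : ℝ} {x y : Fin k → ℝ}
    (hx : x ∈ innerThinning A W δ) (hy : y ∈ A) (h : dist x y ≤ δ) : y ∈ W := by
  by_contra hW
  exact hx.2 (mem_cthickening_of_dist_le x y δ _ ⟨hy, hW⟩ h)

theorem tendsto_measure_cthickening_of_relFrontier_null [IsFiniteMeasureOnCompacts κ]
    (hA : κ Aᶜ = 0) (hr : κ (relFrontier A W) = 0) (hW : IsBounded W) :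
    Tendsto (fun δ => κ (cthickening δ W)) (𝓝 0) (𝓝 (κ W)) := by
  rw [← measure_closure_eq_of_relFrontier_null hA hr]
  exact tendsto_measure_cthickening
    ⟨1, one_pos, hW.cthickening.measure_lt_top.ne⟩

theorem tendsto_measure_innerThinning [IsFiniteMeasureOnCompacts κ]
    (hA : κ Aᶜ = 0) (hr : κ (relFrontier A W) = 0) (hW : IsBounded W) :
    Tendsto (fun δ => κ (innerThinning A W δ)) (𝓝 0) (𝓝 (κ W)) := by
  have hfin : κ (closure W) ≠ ⊤ := hW.closure.measure_lt_top.ne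
  have : IsFiniteMeasure (κ.restrict (closure W)) :=
    ⟨by rw [Measure.restrict_apply_univ]; exact hfin.lt_top⟩
  have hlim : Tendsto (fun δ => κ.restrict (closure W) (cthickening δ (A \ W))) (𝓝 0) (𝓝 0) := by
    have h := tendsto_measure_cthickening (μ := κ.restrict (closure W)) (s := A \ W)
      ⟨1, one_pos, measure_ne_top _ _⟩
    have h0 : κ.restrict (closure W) (closure (A \ W)) = 0 := by
      rw [Measure.restrict_apply isClosed_closure.measurableSet]
      refine measure_mono_null (t := Aᶜ ∪ relFrontier A W) ?_ (measure_union_null hA hr)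
      rintro x ⟨h1, h2⟩
      by_cases hxA : x ∈ A
      · exact Or.inr ⟨⟨hxA, h2⟩, h1⟩
      · exact Or.inl hxA
    rwa [h0] at h
  have heq : ∀ δ, κ (innerThinning A W δ) =
      κ W - κ.restrict (closure W) (cthickening δ (A \ W)) := by
    intro δ
    rw [← measure_closure_eq_of_relFrontier_null hA hr,
      Measure.restrict_apply isClosed_cthickening.measurableSet, inter_comm, innerThinning,
      ← sdiff_self_inter, measure_sdiff inter_subset_left
        (isClosed_closure.inter isClosed_cthickening).measurableSet.nullMeasurableSet
        (measure_ne_top_of_subset inter_subset_left hfin)]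
  simp_rw [heq]
  simpa using ENNReal.Tendsto.sub tendsto_const_nhds hlim (Or.inr ENNReal.zero_ne_top)

theorem preimage_relFrontier (e : (Fin k → ℝ) ≃ₜ (Fin k → ℝ)) (A W : Set (Fin k → ℝ)) :
    e ⁻¹' relFrontier A W = relFrontier (e ⁻¹' A) (e ⁻¹' W) := by
  simp only [relFrontier, preimage_inter, e.preimage_closure, preimage_sdiff]

end RelFrontier

section LatticeCount

variable {E : Type*} [AddCommGroup E] [MeasurableSpace E] [MeasurableAdd E]
  {Λ : AddSubgroup E} [Countable Λ] {κ : Measure E} [VAddInvariantMeasure Λ E κ] {P : Set E}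

/-- Unfolding: integrating the number of lattice translates that land in `B` over a
fundamental domain gives the measure of `B`. -/
theorem measure_eq_setLIntegral_encard (hP : IsAddFundamentalDomain Λ P κ) {B : Set E}
    (hB : MeasurableSet B) :
    κ B = ∫⁻ p in P, ({g : Λ | (g : E) + p ∈ B}.encard : ℝ≥0∞) ∂κ := by
  have hmeas : ∀ g : Λ, MeasurableSet ((fun p : E => (g : E) + p) ⁻¹' B) :=
    fun g => measurable_const_add _ hB
  have h1 : κ B = ∑' g : Λ, ∫⁻ p in P, B.indicator 1 ((g : E) + p) ∂κ := by
    rw [← lintegral_indicator_one hB]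
    exact hP.lintegral_eq_tsum'' _
  rw [h1, ← lintegral_tsum]
  · refine lintegral_congr fun p => ?_
    rw [← ENNReal.tsum_set_one, tsum_subtype {g : Λ | (g : E) + p ∈ B} fun _ => (1 : ℝ≥0∞)]
    rfl
  · exact fun g => ((measurable_one.indicator hB).comp (measurable_const_add _)).aemeasurable

theorem encard_mul_measure_le (hP : IsAddFundamentalDomain Λ P κ) {S B : Set E}
    (hB : MeasurableSet B)
    (h : ∀ᵐ p ∂κ.restrict P, ∃ l : Λ, ∀ g : Λ, (g : E) ∈ S → ((g - l : Λ) : E) + p ∈ B) :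
    ({g : Λ | (g : E) ∈ S}.encard : ℝ≥0∞) * κ P ≤ κ B := by
  rw [measure_eq_setLIntegral_encard hP hB, ← setLIntegral_const]
  refine lintegral_mono_ae ?_
  filter_upwards [h] with p ⟨l, hl⟩
  exact ENat.toENNReal_le.2 (encard_le_encard_of_injOn (f := fun g => g - l) (fun g hg => hl g hg)
    (sub_left_injective.injOn))

theorem measure_le_encard_mul (hP : IsAddFundamentalDomain Λ P κ) {S B : Set E}
    (hB : MeasurableSet B)
    (h : ∀ᵐ p ∂κ.restrict P, ∃ l : Λ, ∀ g : Λ, (g : E) + p ∈ B → ((g + l : Λ) : E) ∈ S) :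
    κ B ≤ ({g : Λ | (g : E) ∈ S}.encard : ℝ≥0∞) * κ P := by
  rw [measure_eq_setLIntegral_encard hP hB, ← setLIntegral_const]
  refine lintegral_mono_ae ?_
  filter_upwards [h] with p ⟨l, hl⟩
  exact ENat.toENNReal_le.2 (encard_le_encard_of_injOn (f := fun g => g + l) (fun g hg => hl g hg)
    (add_left_injective l).injOn)

end LatticeCount

section HaarOn

variable {k : ℕ} {H : AddSubgroup (Fin k → ℝ)} {κ : Measure (Fin k → ℝ)}

theorem IsHaarOn.isFiniteMeasureOnCompacts {A : Set (Fin k → ℝ)} (h : IsHaarOn A κ) :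
    IsFiniteMeasureOnCompacts κ :=
  ⟨fun {_} hC => h.2.2.1 _ hC⟩

theorem IsHaarOn.isAddHaarMeasure_comap (h : IsHaarOn (H : Set (Fin k → ℝ)) κ)
    (hH : IsClosed (H : Set (Fin k → ℝ))) :
    (κ.comap ((↑) : H → Fin k → ℝ)).IsAddHaarMeasure := by
  have hemb : MeasurableEmbedding ((↑) : H → Fin k → ℝ) :=
    MeasurableEmbedding.subtype_coe hH.measurableSet
  refine { lt_top_of_isCompact := ?_, map_add_left_eq_self := ?_, open_pos := ?_ }
  · intro C hC
    rw [hemb.comap_apply]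
    exact h.2.2.1 _ (hC.image continuous_subtype_val)
  · intro g
    ext s hs
    rw [Measure.map_apply (measurable_const_add g) hs, hemb.comap_apply, hemb.comap_apply,
      ← h.2.1 g g.2, Measure.map_apply (measurable_const_add _) (hemb.measurableSet_image.2 hs),
      h.2.1 g g.2]
    congr 1
    ext x
    constructor
    · rintro ⟨y, hy, rfl⟩
      exact ⟨g + y, hy, rfl⟩
    · rintro ⟨y, hy, hyx⟩
      have hx : x = ((y - g : H) : Fin k → ℝ) := by
        rw [AddSubgroup.coe_sub, hyx]; simp
      exact ⟨y - g, by simpa using hy, hx.symm⟩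
  · rintro U hU ⟨x, hx⟩
    obtain ⟨V, hV, rfl⟩ := isOpen_induced_iff.1 hU
    have himage : ((↑) : H → Fin k → ℝ) '' (((↑) : H → Fin k → ℝ) ⁻¹' V) = V ∩ H := by
      rw [inter_comm]
      exact Subtype.image_preimage_coe (H : Set (Fin k → ℝ)) V
    rw [hemb.comap_apply, himage]
    exact (h.2.2.2 V hV ⟨x, hx, x.2⟩).ne'

/-- The identity component of a closed subgroup of `ℝ^k`, as a subgroup of `ℝ^k`. -/
def identityComponent (H : AddSubgroup (Fin k → ℝ)) : AddSubgroup (Fin k → ℝ) :=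
  (AddSubgroup.connectedComponentOfZero H).map H.subtype

theorem coe_identityComponent (H : AddSubgroup (Fin k → ℝ)) :
    (identityComponent H : Set (Fin k → ℝ)) =
      connectedComponentIn (H : Set (Fin k → ℝ)) 0 := by
  rw [connectedComponentIn_eq_image H.zero_mem]
  rfl

theorem isClosed_identityComponent (hH : IsClosed (H : Set (Fin k → ℝ))) :
    IsClosed (identityComponent H : Set (Fin k → ℝ)) :=
  hH.isClosedMap_subtype_val _ isClosed_connectedComponent

/-- If the identity component has positive Haar measure, it is relatively open (Steinhaus). -/
theorem IsHaarOn.exists_isOpen_inter_subset_identityComponent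
    (h : IsHaarOn (H : Set (Fin k → ℝ)) κ) (hH : IsClosed (H : Set (Fin k → ℝ)))
    (hpos : 0 < κ (identityComponent H)) :
    ∃ U : Set (Fin k → ℝ), IsOpen U ∧ 0 ∈ U ∧
      U ∩ H ⊆ (identityComponent H : Set (Fin k → ℝ)) := by
  have := h.isAddHaarMeasure_comap hH
  have hemb : MeasurableEmbedding ((↑) : H → Fin k → ℝ) :=
    MeasurableEmbedding.subtype_coe hH.measurableSet
  have : LocallyCompactSpace H := hH.isClosedEmbedding_subtypeVal.locallyCompactSpace
  have hnhds := Measure.sub_mem_nhds_zero_of_addHaar_pos (κ.comap ((↑) : H → Fin k → ℝ))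
    (AddSubgroup.connectedComponentOfZero H : Set H) isClosed_connectedComponent.measurableSet
    (by rw [hemb.comap_apply]; exact hpos)
  obtain ⟨t, ht, htopen, h0⟩ := _root_.mem_nhds_iff.1 hnhds
  obtain ⟨U, hU, rfl⟩ := isOpen_induced_iff.1 htopen
  refine ⟨U, hU, h0, ?_⟩
  rintro x ⟨hxU, hxH⟩
  obtain ⟨a, ha, b, hb, hab⟩ := ht (show (⟨x, hxH⟩ : H) ∈ _ from hxU)
  exact ⟨⟨x, hxH⟩, hab ▸ sub_mem ha hb, rfl⟩

end HaarOn

section PhysProdMeasure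

variable {d m : ℕ} {κ : Measure (Fin m → ℝ)}

theorem continuous_projPhys : Continuous (projPhys d m) :=
  continuous_pi fun _ => continuous_apply _

theorem continuous_projInt : Continuous (projInt d m) :=
  continuous_pi fun _ => continuous_apply _

@[simp]
theorem projPhys_pairEmbed (x : Fin d → ℝ) (z : Fin m → ℝ) :
    projPhys d m (pairEmbed d m x z) = x := by
  ext i; simp [projPhys, pairEmbed]

@[simp]
theorem projInt_pairEmbed (x : Fin d → ℝ) (z : Fin m → ℝ) :
    projInt d m (pairEmbed d m x z) = z := by
  ext i; simp [projInt, pairEmbed]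

theorem add_pairEmbed (y : Fin (d + m) → ℝ) (x : Fin d → ℝ) (z : Fin m → ℝ) :
    y + pairEmbed d m x z = pairEmbed d m (projPhys d m y + x) (projInt d m y + z) := by
  ext i
  refine Fin.addCases (fun i => ?_) (fun i => ?_) i <;> simp [projPhys, projInt, pairEmbed]

theorem measurable_pairEmbed :
    Measurable fun p : (Fin d → ℝ) × (Fin m → ℝ) => pairEmbed d m p.1 p.2 := by
  refine measurable_pi_lambda _ fun i => ?_
  refine Fin.addCases (fun i => ?_) (fun i => ?_) i <;> simp only [pairEmbed, Fin.append_left,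
    Fin.append_right] <;> fun_prop

theorem physProdMeasure_prod [SFinite κ] {X : Set (Fin d → ℝ)} {Y : Set (Fin m → ℝ)}
    (hX : MeasurableSet X) (hY : MeasurableSet Y) :
    physProdMeasure d m κ {y | projPhys d m y ∈ X ∧ projInt d m y ∈ Y} = volume X * κ Y := by
  have hmeas : MeasurableSet {y | projPhys d m y ∈ X ∧ projInt d m y ∈ Y} :=
    (continuous_projPhys.measurable hX).inter (continuous_projInt.measurable hY)
  rw [physProdMeasure, Measure.map_apply measurable_pairEmbed hmeas, ← Measure.prod_prod]
  congr 1
  ext p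
  simp

theorem ae_physProdMeasure_projInt_mem [SFinite κ] {A : Set (Fin m → ℝ)} (hA : MeasurableSet A)
    (h : κ Aᶜ = 0) : ∀ᵐ y ∂physProdMeasure d m κ, projInt d m y ∈ A := by
  have := physProdMeasure_prod (d := d) (κ := κ) MeasurableSet.univ hA.compl
  rw [h, mul_zero] at this
  simpa [ae_iff] using this

theorem physProdMeasure_restrict [SFinite κ] {C : Set (Fin m → ℝ)}
    {B : Set (Fin (d + m) → ℝ)} (hB : MeasurableSet B) (hBC : B ⊆ {y | projInt d m y ∈ C}) :
    physProdMeasure d m (κ.restrict C) B = physProdMeasure d m κ B := by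
  rw [physProdMeasure, physProdMeasure, Measure.map_apply measurable_pairEmbed hB,
    Measure.map_apply measurable_pairEmbed hB, ← Measure.restrict_univ (μ := volume),
    Measure.prod_restrict, Measure.restrict_apply (measurable_pairEmbed hB),
    Measure.restrict_univ, inter_eq_left.2]
  intro p hp
  simpa using hBC hp

theorem map_add_physProdMeasure [SFinite κ] (g : Fin (d + m) → ℝ)
    (hg : Measure.map (fun z => projInt d m g + z) κ = κ) :
    Measure.map (fun y => g + y) (physProdMeasure d m κ) = physProdMeasure d m κ := by
  rw [physProdMeasure, Measure.map_map (measurable_const_add g) measurable_pairEmbed]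
  conv_rhs => rw [← hg, ← map_add_left_eq_self volume (projPhys d m g),
    Measure.map_prod_map _ _ (measurable_const_add _) (measurable_const_add _),
    Measure.map_map measurable_pairEmbed
      ((measurable_const_add _).prodMap (measurable_const_add _))]
  congr 1
  ext1 p
  exact add_pairEmbed g p.1 p.2

theorem measure_physProdMeasure_pos {B : Set (Fin (d + m) → ℝ)} {C : Set (Fin m → ℝ)}
    [SFinite κ] (hB : 0 < physProdMeasure d m (κ.restrict C) B) : 0 < κ C := by
  by_contra! h
  rw [Measure.restrict_eq_zero.2 (nonpos_iff_eq_zero.1 h)] at hB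
  simp [physProdMeasure] at hB

end PhysProdMeasure

section Lattice

theorem IsFullLattice.exists_basis {n : ℕ} {L : Set (Fin n → ℝ)} (hL : IsFullLattice L) :
    ∃ b : Module.Basis (Fin n) ℝ (Fin n → ℝ),
      L = ((Submodule.span ℤ (range b)).toAddSubgroup : Set (Fin n → ℝ)) := by
  obtain ⟨M, hM, rfl⟩ := hL
  have hli : LinearIndependent ℝ M.row :=
    Matrix.linearIndependent_rows_iff_isUnit.2 ((Matrix.isUnit_iff_isUnit_det M).2 hM)
  refine ⟨basisOfLinearIndependentOfCardEqFinrank' M.row hli (by simp), ?_⟩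
  ext y
  rw [coe_basisOfLinearIndependentOfCardEqFinrank']
  change y ∈ range _ ↔ y ∈ Submodule.span ℤ (range M.row)
  rw [Submodule.mem_span_range_iff_exists_fun]
  refine exists_congr fun c => ?_
  change Matrix.vecMul _ M = y ↔ _
  rw [Matrix.vecMul_eq_sum]
  simp [Matrix.row, Int.cast_smul_eq_zsmul]

theorem IsAffineLattice.exists_basis {n : ℕ} {L : Set (Fin n → ℝ)} (hL : IsAffineLattice L)
    {y₀ : Fin n → ℝ} (hy₀ : y₀ ∈ L) :
    ∃ b : Module.Basis (Fin n) ℝ (Fin n → ℝ),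
      {z | ∃ y ∈ L, ∃ y' ∈ L, z = y - y'} =
        ((Submodule.span ℤ (range b)).toAddSubgroup : Set (Fin n → ℝ)) ∧
      L = (y₀ + ·) '' ((Submodule.span ℤ (range b)).toAddSubgroup : Set (Fin n → ℝ)) := by
  obtain ⟨L₀, c, hL₀, rfl⟩ := hL
  obtain ⟨b, rfl⟩ := hL₀.exists_basis
  refine ⟨b, ?_⟩
  generalize (Submodule.span ℤ (range b)).toAddSubgroup = Λ at *
  obtain ⟨g₀, hg₀, rfl⟩ := hy₀
  constructor
  · ext z
    constructor
    · rintro ⟨_, ⟨g, hg, rfl⟩, _, ⟨g', hg', rfl⟩, rfl⟩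
      simpa using sub_mem hg hg'
    · exact fun hz => ⟨c + z, ⟨z, hz, rfl⟩, c + 0, ⟨0, zero_mem _, rfl⟩, by simp⟩
  · ext z
    constructor
    · rintro ⟨g, hg, rfl⟩
      exact ⟨g - g₀, sub_mem hg hg₀, by simp⟩
    · rintro ⟨g, hg, rfl⟩
      exact ⟨g₀ + g, add_mem hg₀ hg, (add_assoc _ _ _).symm⟩

variable {d m : ℕ} {Λ : AddSubgroup (Fin (d + m) → ℝ)}

/-- The closure of the projection of `Λ` to the internal space, as a subgroup. -/
def internalClosure (d m : ℕ) (Λ : AddSubgroup (Fin (d + m) → ℝ)) : AddSubgroup (Fin m → ℝ) :=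
  (Λ.map (AddMonoidHom.mk' (projInt d m) fun _ _ => rfl)).topologicalClosure

theorem exists_dist_projInt_le_dist_projPhys_le {P : Set (Fin (d + m) → ℝ)} (hP : IsBounded P)
    {δ : ℝ} (hδ : 0 < δ) :
    ∃ R > 0, ∀ p ∈ P, projInt d m p ∈ closure (projInt d m '' Λ) → ∃ l ∈ Λ,
      dist (projInt d m p) (projInt d m l) ≤ δ ∧ dist (projPhys d m p) (projPhys d m l) ≤ R := by
  have hK : IsCompact (projInt d m '' closure P ∩ closure (projInt d m '' (Λ : Set _))) :=
    (hP.isCompact_closure.image continuous_projInt).inter_right isClosed_closure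
  obtain ⟨t, ht⟩ := hK.elim_finite_subcover (fun l : Λ => ball (projInt d m l) δ)
    (fun _ => isOpen_ball) (by
      rintro z ⟨-, hz⟩
      obtain ⟨_, ⟨l, hl, rfl⟩, hdist⟩ := Metric.mem_closure_iff.1 hz δ hδ
      exact mem_iUnion.2 ⟨⟨l, hl⟩, hdist⟩)
  have hbdd : IsBounded (projPhys d m '' closure P ∪ (fun l : Λ => projPhys d m l) '' t) :=
    (hP.isCompact_closure.image continuous_projPhys).isBounded.union
      (t.finite_toSet.image _).isBounded
  obtain ⟨R, hR, hRb⟩ := hbdd.exists_pos_norm_le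
  refine ⟨R + R, by positivity, fun p hp hpA => ?_⟩
  obtain ⟨l, hl⟩ := mem_iUnion.1 (ht ⟨⟨p, subset_closure hp, rfl⟩, hpA⟩)
  obtain ⟨hlt, hl⟩ := mem_iUnion.1 hl
  refine ⟨l, l.2, (mem_ball.1 hl).le, (dist_le_norm_add_norm _ _).trans (add_le_add ?_ ?_)⟩
  · exact hRb _ (Or.inl ⟨p, subset_closure hp, rfl⟩)
  · exact hRb _ (Or.inr ⟨l, hlt, rfl⟩)

theorem vaddInvariantMeasure_physProdMeasure {κ : Measure (Fin m → ℝ)} [SFinite κ]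
    (h : IsHaarOn (closure (projInt d m '' Λ)) κ) :
    VAddInvariantMeasure Λ (Fin (d + m) → ℝ) (physProdMeasure d m κ) where
  measure_preimage_vadd g s hs := by
    rw [← Measure.map_apply (measurable_const_vadd g) hs]
    exact congrArg (· s) (map_add_physProdMeasure (g : Fin (d + m) → ℝ)
      (h.2.1 _ (subset_closure ⟨g, g.2, rfl⟩)))

/-- A fundamental domain for `Λ ∩ (ℝ^d × A°)` in `ℝ^d × A°` is also one for `Λ` in
`ℝ^d × A`. -/
theorem isAddFundamentalDomain_of_identityComponent {κ : Measure (Fin m → ℝ)}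
    [SFinite κ] (h : IsHaarOn (internalClosure d m Λ : Set (Fin m → ℝ)) κ)
    (hpos : 0 < κ (identityComponent (internalClosure d m Λ)))
    {F : Set (Fin (d + m) → ℝ)} (hFm : MeasurableSet F)
    (hFV : F ⊆ {y | projInt d m y ∈ identityComponent (internalClosure d m Λ)})
    (hF : ∀ x ∈ {y | projInt d m y ∈ identityComponent (internalClosure d m Λ)},
      ∃! y, y ∈ F ∧ y - x ∈
        (Λ : Set _) ∩ {y | projInt d m y ∈ identityComponent (internalClosure d m Λ)}) :
    IsAddFundamentalDomain Λ F (physProdMeasure d m κ) where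
  nullMeasurableSet := hFm.nullMeasurableSet
  ae_covers := by
    have hclosed : IsClosed (internalClosure d m Λ : Set (Fin m → ℝ)) := isClosed_closure
    obtain ⟨U, hU, hU0, hUsub⟩ := h.exists_isOpen_inter_subset_identityComponent hclosed hpos
    filter_upwards [ae_physProdMeasure_projInt_mem hclosed.measurableSet h.1] with y hy
    have hneg : -projInt d m y ∈ closure (projInt d m '' (Λ : Set _)) :=
      (internalClosure d m Λ).neg_mem hy
    obtain ⟨_, hlU, l, hl, rfl⟩ := mem_closure_iff.1 hneg ((projInt d m y + ·) ⁻¹' U)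
      (hU.preimage (continuous_const_add _)) (by simpa using hU0)
    have hmem : projInt d m (y + l) ∈ identityComponent (internalClosure d m Λ) :=
      hUsub ⟨hlU, add_mem hy (subset_closure ⟨l, hl, rfl⟩ :
        projInt d m l ∈ (internalClosure d m Λ : Set _))⟩
    obtain ⟨f, ⟨hfF, hfΛ, -⟩, -⟩ := hF _ hmem
    refine ⟨⟨f - (y + l) + l, add_mem hfΛ hl⟩, ?_⟩
    rw [AddSubgroup.vadd_def, vadd_eq_add]
    convert hfF using 1
    simp only
    abel
  aedisjoint := by
    intro g g' hg
    refine Disjoint.aedisjoint (disjoint_left.2 ?_)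
    rintro _ ⟨f, hf, rfl⟩ ⟨f', hf', hff'⟩
    have hsum : (g' : Fin (d + m) → ℝ) + f' = g + f := hff'
    have hdiff : f' - f ∈ Λ := by
      have : f' - f = g - g' := by rw [sub_eq_sub_iff_add_eq_add, add_comm f', hsum]
      exact this ▸ sub_mem g.2 g'.2
    have heq : f' = f := (hF f (hFV hf)).unique
      ⟨hf', hdiff, (identityComponent (internalClosure d m Λ)).sub_mem (hFV hf') (hFV hf)⟩
      ⟨hf, by simp, by
        rw [sub_self]
        exact (identityComponent (internalClosure d m Λ)).zero_mem⟩
    subst heq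
    exact hg (Subtype.ext (add_right_cancel hsum).symm)

end Lattice

section Count

variable {d m : ℕ} {Λ : AddSubgroup (Fin (d + m) → ℝ)}

/-- Points whose physical component lies in `x + T • D` and whose internal component lies
in `W`, for `T ≠ 0`. -/
def countingRegion (d m : ℕ) (D : Set (Fin d → ℝ)) (W : Set (Fin m → ℝ)) (T : ℝ)
    (x : Fin d → ℝ) : Set (Fin (d + m) → ℝ) :=
  {y | projPhys d m y ∈ (fun z => T⁻¹ • (z - x)) ⁻¹' D ∧ projInt d m y ∈ W}

theorem measurable_inv_smul_sub (T : ℝ) (x : Fin d → ℝ) :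
    Measurable fun z : Fin d → ℝ => T⁻¹ • (z - x) := by
  fun_prop

theorem measurableSet_countingRegion {D : Set (Fin d → ℝ)} {W : Set (Fin m → ℝ)}
    (hD : MeasurableSet D) (hW : MeasurableSet W) (T : ℝ) (x : Fin d → ℝ) :
    MeasurableSet (countingRegion d m D W T x) :=
  (continuous_projPhys.measurable (measurable_inv_smul_sub T x hD)).inter
    (continuous_projInt.measurable hW)

theorem physProdMeasure_countingRegion {κ : Measure (Fin m → ℝ)} [SFinite κ]
    {D : Set (Fin d → ℝ)} {W : Set (Fin m → ℝ)}
    (hD : MeasurableSet D) (hW : MeasurableSet W) {T : ℝ} (hT : 0 < T) (x : Fin d → ℝ) :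
    physProdMeasure d m κ (countingRegion d m D W T x) =
      ENNReal.ofReal (T ^ d) * (volume D * κ W) := by
  rw [countingRegion, physProdMeasure_prod (measurable_inv_smul_sub T x hD) hW, ← mul_assoc]
  congr 1
  have hpre : (fun z => T⁻¹ • (z - x)) ⁻¹' D =
      (fun z => z + -x) ⁻¹' ((fun z : Fin d → ℝ => T⁻¹ • z) ⁻¹' D) := by
    ext z; simp [sub_eq_add_neg]
  rw [hpre, measure_preimage_add_right, Measure.addHaar_preimage_smul _ (inv_ne_zero hT.ne')]
  simp [abs_of_pos hT]

theorem dist_inv_smul_sub_le {T R δ : ℝ} (hT : 0 < T) (hR : R ≤ T * δ)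
    (x : Fin d → ℝ) {z z' : Fin d → ℝ} (h : dist z z' ≤ R) :
    dist (T⁻¹ • (z - x)) (T⁻¹ • (z' - x)) ≤ δ := by
  rw [dist_smul₀, dist_sub_right, norm_inv, Real.norm_of_nonneg hT.le, inv_mul_le_iff₀ hT]
  exact h.trans hR

theorem dist_sub_add_left_self {E : Type*} [SeminormedAddCommGroup E] (a b c : E) :
    dist (a - b + c) a = dist c b := by
  rw [dist_eq_norm, dist_eq_norm]
  congr 1
  abel

theorem exists_encard_mul_bounds [Countable Λ] {κ : Measure (Fin m → ℝ)} [SFinite κ]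
    (h : IsHaarOn (closure (projInt d m '' Λ)) κ) {P : Set (Fin (d + m) → ℝ)}
    (hPb : IsBounded P) (hPm : MeasurableSet P)
    (hP : IsAddFundamentalDomain Λ P (physProdMeasure d m κ))
    (D : Set (Fin d → ℝ)) (W : Set (Fin m → ℝ)) {δ : ℝ} (hδ : 0 < δ) :
    ∃ T₀ > (0 : ℝ), ∀ T, T₀ ≤ T → ∀ x : Fin d → ℝ,
      ENNReal.ofReal (T ^ d) * (volume (innerThinning univ D δ) *
          κ (innerThinning (closure (projInt d m '' Λ)) W δ)) ≤
        ({g : Λ | (g : Fin (d + m) → ℝ) ∈ countingRegion d m D W T x}.encard : ℝ≥0∞) *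
          physProdMeasure d m κ P ∧
      ({g : Λ | (g : Fin (d + m) → ℝ) ∈ countingRegion d m D W T x}.encard : ℝ≥0∞) *
          physProdMeasure d m κ P ≤
        ENNReal.ofReal (T ^ d) * (volume (cthickening δ D) * κ (cthickening δ W)) := by
  have := vaddInvariantMeasure_physProdMeasure h
  obtain ⟨R, hR, hRP⟩ := exists_dist_projInt_le_dist_projPhys_le (Λ := Λ) hPb hδ
  have hae : ∀ᵐ p ∂(physProdMeasure d m κ).restrict P, ∃ l : Λ,
      dist (projInt d m p) (projInt d m l) ≤ δ ∧ dist (projPhys d m p) (projPhys d m l) ≤ R := by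
    filter_upwards [ae_restrict_mem hPm, ae_restrict_of_ae
      (ae_physProdMeasure_projInt_mem isClosed_closure.measurableSet h.1)] with p hp hpA
    obtain ⟨l, hl, hl'⟩ := hRP p hp hpA
    exact ⟨⟨l, hl⟩, hl'⟩
  refine ⟨R / δ, by positivity, fun T hTR x => ?_⟩
  have hT : 0 < T := lt_of_lt_of_le (by positivity) hTR
  have hRT : R ≤ T * δ := (div_le_iff₀ hδ).1 hTR
  constructor
  · rw [← physProdMeasure_countingRegion (measurableSet_innerThinning δ)
      (measurableSet_innerThinning δ) hT x]
    refine measure_le_encard_mul hP (measurableSet_countingRegion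
      (measurableSet_innerThinning δ) (measurableSet_innerThinning δ) T x) ?_
    filter_upwards [hae] with p ⟨l, hli, hlp⟩
    refine ⟨l, fun g hg => ⟨?_, ?_⟩⟩
    · have hdist : dist (projPhys d m ((g : Fin (d + m) → ℝ) + p))
          (projPhys d m ((g + l : Λ) : Fin (d + m) → ℝ)) ≤ R := by
        change dist (projPhys d m g + projPhys d m p) (projPhys d m g + projPhys d m l) ≤ R
        rwa [dist_add_left]
      exact mem_of_dist_le_of_mem_innerThinning (A := univ) (W := D)
        (x := T⁻¹ • (projPhys d m ((g : Fin (d + m) → ℝ) + p) - x))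
        (y := T⁻¹ • (projPhys d m ((g + l : Λ) : Fin (d + m) → ℝ) - x)) hg.1 (mem_univ _)
        (dist_inv_smul_sub_le hT hRT x hdist)
    · have hdist : dist (projInt d m ((g : Fin (d + m) → ℝ) + p))
          (projInt d m ((g + l : Λ) : Fin (d + m) → ℝ)) ≤ δ := by
        change dist (projInt d m g + projInt d m p) (projInt d m g + projInt d m l) ≤ δ
        rwa [dist_add_left]
      exact mem_of_dist_le_of_mem_innerThinning hg.2 (subset_closure ⟨_, (g + l).2, rfl⟩) hdist
  · rw [← physProdMeasure_countingRegion isClosed_cthickening.measurableSet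
      isClosed_cthickening.measurableSet hT x]
    refine encard_mul_measure_le hP (measurableSet_countingRegion
      isClosed_cthickening.measurableSet isClosed_cthickening.measurableSet T x) ?_
    filter_upwards [hae] with p ⟨l, hli, hlp⟩
    refine ⟨l, fun g hg => ⟨?_, ?_⟩⟩
    · have hdist : dist (projPhys d m (((g - l : Λ) : Fin (d + m) → ℝ) + p))
          (projPhys d m g) ≤ R := by
        change dist (projPhys d m g - projPhys d m l + projPhys d m p) (projPhys d m g) ≤ R
        rwa [dist_sub_add_left_self]
      exact mem_cthickening_of_dist_le _ _ δ D hg.1 (dist_inv_smul_sub_le hT hRT x hdist)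
    · have hdist : dist (projInt d m (((g - l : Λ) : Fin (d + m) → ℝ) + p))
          (projInt d m g) ≤ δ := by
        change dist (projInt d m g - projInt d m l + projInt d m p) (projInt d m g) ≤ δ
        rwa [dist_sub_add_left_self]
      exact mem_cthickening_of_dist_le _ _ δ W hg.2 hdist

theorem exists_abs_ncard_div_sub_lt [Countable Λ] {κ : Measure (Fin m → ℝ)}
    (h : IsHaarOn (closure (projInt d m '' Λ)) κ) {P : Set (Fin (d + m) → ℝ)}
    (hPb : IsBounded P) (hPm : MeasurableSet P)
    (hP : IsAddFundamentalDomain Λ P (physProdMeasure d m κ))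
    (hP0 : 0 < physProdMeasure d m κ P) (hPfin : physProdMeasure d m κ P < ⊤)
    {D : Set (Fin d → ℝ)} (hDb : IsBounded D)
    (hDreg : (volume : Measure (Fin d → ℝ)) (frontier D) = 0)
    {W : Set (Fin m → ℝ)} (hWb : IsBounded W)
    (hWreg : κ (relFrontier (closure (projInt d m '' Λ)) W) = 0) {ε : ℝ} (hε : 0 < ε) :
    ∃ T₀ > (0 : ℝ), ∀ T, T₀ ≤ T → ∀ x : Fin d → ℝ,
      |({g : Λ | (g : Fin (d + m) → ℝ) ∈ countingRegion d m D W T x}.ncard : ℝ) / T ^ d -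
        (volume D).toReal * (κ W).toReal / (physProdMeasure d m κ P).toReal| < ε := by
  have := h.isFiniteMeasureOnCompacts
  have hDreg' : (volume : Measure (Fin d → ℝ)) (relFrontier univ D) = 0 := by
    rwa [relFrontier, univ_inter, ← compl_eq_univ_sdiff, ← frontier_eq_closure_inter_closure]
  have hD0 : (volume : Measure (Fin d → ℝ)) univᶜ = 0 := by simp
  have hDfin : volume D ≠ ⊤ := hDb.measure_lt_top.ne
  have hWfin : κ W ≠ ⊤ := hWb.measure_lt_top.ne
  set p := (physProdMeasure d m κ P).toReal with hp
  have hp0 : 0 < p := ENNReal.toReal_pos hP0.ne' hPfin.ne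
  have hlim : ∀ {f : ℝ → ℝ≥0∞} {g : ℝ → ℝ≥0∞}, Tendsto f (𝓝 0) (𝓝 (volume D)) →
      Tendsto g (𝓝 0) (𝓝 (κ W)) → Tendsto (fun δ => (f δ).toReal * (g δ).toReal / p) (𝓝[>] 0)
        (𝓝 ((volume D).toReal * (κ W).toReal / p)) := fun hf hg =>
    ((((ENNReal.tendsto_toReal hDfin).comp hf).mul
      ((ENNReal.tendsto_toReal hWfin).comp hg)).div_const p).mono_left nhdsWithin_le_nhds
  have hupper := hlim (tendsto_measure_cthickening_of_relFrontier_null hD0 hDreg' hDb)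
    (tendsto_measure_cthickening_of_relFrontier_null h.1 hWreg hWb)
  have hlower := hlim (tendsto_measure_innerThinning hD0 hDreg' hDb)
    (tendsto_measure_innerThinning h.1 hWreg hWb)
  obtain ⟨δ, ⟨hup, hlo⟩, hδ⟩ := ((((Metric.tendsto_nhds.1 hupper) ε hε).and
    ((Metric.tendsto_nhds.1 hlower) ε hε)).and self_mem_nhdsWithin).exists
  obtain ⟨T₀, hT₀, hbound⟩ := exists_encard_mul_bounds h hPb hPm hP D W hδ
  refine ⟨T₀, hT₀, fun T hT x => ?_⟩
  have hTpos : 0 < T ^ d := pow_pos (hT₀.trans_le hT) d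
  obtain ⟨h1, h2⟩ := hbound T hT x
  have hUfin : ENNReal.ofReal (T ^ d) * (volume (cthickening δ D) * κ (cthickening δ W)) ≠ ⊤ :=
    ENNReal.mul_ne_top ENNReal.ofReal_ne_top
      (ENNReal.mul_ne_top hDb.cthickening.measure_lt_top.ne hWb.cthickening.measure_lt_top.ne)
  have hcount : (({g : Λ | (g : Fin (d + m) → ℝ) ∈ countingRegion d m D W T x}.encard :
      ℝ≥0∞)).toReal = {g : Λ | (g : Fin (d + m) → ℝ) ∈ countingRegion d m D W T x}.ncard := by
    obtain hfin | hinf := (Set.finite_or_infinite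
      {g : Λ | (g : Fin (d + m) → ℝ) ∈ countingRegion d m D W T x})
    · rw [← hfin.cast_ncard_eq]
      simp
    · rw [hinf.encard_eq, hinf.ncard]
      simp
  have h1' := ENNReal.toReal_mono (ne_top_of_le_ne_top hUfin h2) h1
  have h2' := ENNReal.toReal_mono hUfin h2
  simp only [ENNReal.toReal_mul, ENNReal.toReal_ofReal hTpos.le, hcount, ← hp] at h1' h2'
  rw [Real.dist_eq, abs_lt] at hup hlo
  rw [abs_lt]
  have hle : ∀ {a b : ℝ}, T ^ d * a ≤ b * p → a / p ≤ b / T ^ d := fun hab => by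
    rw [div_le_div_iff₀ hp0 hTpos]; linarith
  have hge : ∀ {a b : ℝ}, b * p ≤ T ^ d * a → b / T ^ d ≤ a / p := fun hab => by
    rw [div_le_div_iff₀ hTpos hp0]; linarith
  have h3 := hle h1'
  have h4 := hge h2'
  constructor <;> linarith

end Count

end UniformCounting

/-- **Proposition 3.2** (Marklof–Strömbergsson, quasicrystal paper): uniform
Weyl-type counting.  For an affine lattice `L`, a Haar measure `μ₀` of
`A₀ = closure(π_int(L₀))` translated to `μ` on `A = closure(π_int(L))`, and a Borel
fundamental domain `Fd` of the lattice `L₀ ∩ V` in `V = ℝ^d × A°` with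
`νV = vol_{ℝ^d} × μ₀|_{A°}`:  for every bounded `W ⊆ A` with `μ`-null relative
boundary and every bounded `D ⊆ ℝ^d` with Lebesgue-null boundary,
`#{y ∈ L : π(y) ∈ x + T·D, π_int(y) ∈ W}/T^d → vol(D)·μ(W)/νV(Fd)` as `T → ∞`,
uniformly in `x ∈ ℝ^d`. -/
theorem weyl_counting_uniform
    (d m : ℕ) (hd : 2 ≤ d) (hm : 1 ≤ m)
    (L : Set (Fin (d + m) → ℝ)) (hL : IsAffineLattice L)
    (L₀ : Set (Fin (d + m) → ℝ))
    (hL₀ : L₀ = {z | ∃ y ∈ L, ∃ y' ∈ L, z = y - y'})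
    (μ₀ : Measure (Fin m → ℝ)) (hμ₀ : IsHaarOn (closure (projInt d m '' L₀)) μ₀)
    (y₀ : Fin (d + m) → ℝ) (hy₀ : y₀ ∈ L)
    (μ : Measure (Fin m → ℝ)) (hμ : μ = Measure.map (fun z => projInt d m y₀ + z) μ₀)
    (νV : Measure (Fin (d + m) → ℝ))
    (hνV : νV = physProdMeasure d m
      (μ₀.restrict (connectedComponentIn (closure (projInt d m '' L₀)) 0)))
    (Fd : Set (Fin (d + m) → ℝ)) (hFdm : MeasurableSet Fd)
    (hFdV : Fd ⊆ {y | projInt d m y ∈ connectedComponentIn (closure (projInt d m '' L₀)) 0})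
    (hFd : ∀ x ∈ {y | projInt d m y ∈ connectedComponentIn (closure (projInt d m '' L₀)) 0},
      ∃! y, y ∈ Fd ∧ y - x ∈
        L₀ ∩ {y | projInt d m y ∈ connectedComponentIn (closure (projInt d m '' L₀)) 0})
    (hFdpos : 0 < νV Fd) (hFdfin : νV Fd < ⊤)
    (W : Set (Fin m → ℝ)) (hWsub : W ⊆ closure (projInt d m '' L))
    (hWb : IsBounded W)
    (hWreg : μ (relFrontier (closure (projInt d m '' L)) W) = 0)
    (D : Set (Fin d → ℝ)) (hDb : IsBounded D)
    (hDreg : (volume : Measure (Fin d → ℝ)) (frontier D) = 0) :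
    ∀ ε > (0 : ℝ), ∃ T₀ > (0 : ℝ), ∀ T : ℝ, T₀ ≤ T → ∀ x : Fin d → ℝ,
      |(Set.ncard {y | y ∈ L ∧ (∃ u ∈ D, projPhys d m y = x + T • u) ∧
          projInt d m y ∈ W} : ℝ) / T ^ d
        - (volume D).toReal * (μ W).toReal / (νV Fd).toReal| < ε := by
  obtain ⟨b, hb, hLb⟩ := hL.exists_basis hy₀
  set Λ := (Submodule.span ℤ (Set.range b)).toAddSubgroup
  have hcount : Countable Λ :=
    inferInstanceAs (Countable (Submodule.span ℤ (Set.range b)))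
  obtain rfl : L₀ = Λ := hL₀.trans hb
  have := hμ₀.isFiniteMeasureOnCompacts
  have hcc : connectedComponentIn (closure (projInt d m '' (Λ : Set _))) 0 =
      identityComponent (internalClosure d m Λ) :=
    (coe_identityComponent (internalClosure d m Λ)).symm
  rw [hcc] at hνV hFdV hFd
  have hνFd : νV Fd = physProdMeasure d m μ₀ Fd := by
    rw [hνV, physProdMeasure_restrict hFdm hFdV]
  have hFdom : IsAddFundamentalDomain Λ Fd (physProdMeasure d m μ₀) :=
    isAddFundamentalDomain_of_identityComponent hμ₀
      (measure_physProdMeasure_pos (hνV ▸ hFdpos)) hFdm hFdV hFd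
  have hPdom : IsAddFundamentalDomain Λ (ZSpan.fundamentalDomain b) (physProdMeasure d m μ₀) :=
    ZSpan.isAddFundamentalDomain' b _
  have hinv := vaddInvariantMeasure_physProdMeasure hμ₀
  have hνP : νV Fd = physProdMeasure d m μ₀ (ZSpan.fundamentalDomain b) :=
    hνFd.trans (hFdom.measure_eq hPdom)
  let e : (Fin m → ℝ) ≃ₜ (Fin m → ℝ) := Homeomorph.addLeft (projInt d m y₀)
  have hμe : ∀ S, μ S = μ₀ (e ⁻¹' S) := fun S => by
    rw [hμ]
    exact e.measurableEmbedding.map_apply μ₀ S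
  have heA : e ⁻¹' closure (projInt d m '' L) = closure (projInt d m '' (Λ : Set _)) := by
    rw [e.preimage_closure]
    congr 1
    have himage : projInt d m '' L = e '' (projInt d m '' (Λ : Set _)) := by
      rw [hLb, Set.image_image, Set.image_image]
      rfl
    rw [himage, e.injective.preimage_image]
  have hWe : Bornology.IsBounded (e ⁻¹' W) := by
    have hK : IsCompact (e ⁻¹' closure W) :=
      e.isCompact_preimage.2 hWb.isCompact_closure
    exact hK.isBounded.subset (Set.preimage_mono subset_closure)
  rw [hμe, preimage_relFrontier, heA] at hWreg
  intro ε hε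
  obtain ⟨T₀, hT₀, hT⟩ := exists_abs_ncard_div_sub_lt hμ₀
    (ZSpan.fundamentalDomain_isBounded b) (ZSpan.fundamentalDomain_measurableSet b) hPdom
    (hνP ▸ hFdpos) (hνP ▸ hFdfin) hDb hDreg hWe hWreg hε
  refine ⟨T₀, hT₀, fun T hTT x => ?_⟩
  have hTpos : 0 < T := hT₀.trans_le hTT
  rw [hμe, hνP]
  convert hT T hTT (x - projPhys d m y₀) using 5
  rw [← Set.ncard_image_of_injective
    {g : Λ | (g : Fin (d + m) → ℝ) ∈ countingRegion d m D (e ⁻¹' W) T (x - projPhys d m y₀)}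
    ((add_right_injective y₀).comp Subtype.val_injective)]
  congr 1
  have hregion : ∀ g : Fin (d + m) → ℝ,
      ((∃ u ∈ D, projPhys d m (y₀ + g) = x + T • u) ∧ projInt d m (y₀ + g) ∈ W) ↔
        g ∈ countingRegion d m D (e ⁻¹' W) T (x - projPhys d m y₀) := by
    intro g
    refine and_congr ?_ Iff.rfl
    have hphys : projPhys d m (y₀ + g) = projPhys d m y₀ + projPhys d m g := rfl
    rw [Set.mem_preimage, hphys]
    constructor
    · rintro ⟨u, hu, h⟩
      have hu' : projPhys d m g - (x - projPhys d m y₀) = T • u := by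
        rw [sub_sub_eq_add_sub, add_comm, h, add_sub_cancel_left]
      rwa [hu', inv_smul_smul₀ hTpos.ne']
    · refine fun h => ⟨_, h, ?_⟩
      rw [smul_inv_smul₀ hTpos.ne']
      abel
  ext y
  constructor
  · rintro ⟨hy, hreg⟩
    rw [hLb] at hy
    obtain ⟨g, hg, rfl⟩ := hy
    exact ⟨⟨g, hg⟩, (hregion g).1 hreg, rfl⟩
  · rintro ⟨g, hg, rfl⟩
    refine ⟨?_, (hregion g).2 hg⟩
    rw [hLb]
    exact ⟨g, g.2, rfl⟩
end

section
/- Let L' ⊂ ℝⁿ be an affine lattice, set A = closure of π_int(L') in ℝ^m, and let W be a nonempty subset of A that is open relative to A. Write L'₀ = L' − L' and W₀ = W − W = {w₁ − w₂ : w₁, w₂ ∈ W}. Then the restriction of π to {y ∈ L' : π_int(y) ∈ W} is injective if and only if W₀ ∩ π_int( L'₀ ∩ ({0} × ℝ^m) ) = {0}. -/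
open MeasureTheory Matrix Topology Bornology

/-- An affine lattice is stable under translation by differences of its elements. -/
theorem IsAffineLattice.sub_sub_mem {n : ℕ} {L : Set (Fin n → ℝ)} (hL : IsAffineLattice L)
    {y a b : Fin n → ℝ} (hy : y ∈ L) (ha : a ∈ L) (hb : b ∈ L) : y - (a - b) ∈ L := by
  obtain ⟨L₀, c, ⟨M, -, rfl⟩, rfl⟩ := hL
  obtain ⟨_, ⟨p, rfl⟩, rfl⟩ := hy
  obtain ⟨_, ⟨q, rfl⟩, rfl⟩ := ha
  obtain ⟨_, ⟨r, rfl⟩, rfl⟩ := hb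
  refine ⟨_, ⟨p - (q - r), rfl⟩, ?_⟩
  have h : (fun i => (((p - (q - r)) i : ℤ) : ℝ)) =
      (fun i => (p i : ℝ)) - ((fun i => (q i : ℝ)) - fun i => (r i : ℝ)) := by
    ext i
    simp
  simp only [h, Matrix.sub_vecMul]
  abel

/-- A vector is determined by its physical and internal projections. -/
theorem eq_of_projPhys_eq_of_projInt_eq {d m : ℕ} {y z : Fin (d + m) → ℝ}
    (h : projPhys d m y = projPhys d m z) (h' : projInt d m y = projInt d m z) : y = z := by
  ext i
  induction i using Fin.addCases with
  | left i => exact congrFun h i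
  | right j => exact congrFun h' j

/-- **Claim in proof of Proposition 3.6** (Marklof–Strömbergsson, quasicrystal paper).
For an affine lattice `L'` with `A = closure(π_int(L'))` and a nonempty relatively open
window `W ⊆ A`, the window map `π : {y ∈ L' : π_int(y) ∈ W} → P(W,L')` is injective
if and only if `(W−W) ∩ π_int(L'₀ ∩ ({0} × ℝ^m)) = {0}`, where `L'₀ = L' − L'`. -/
theorem window_injective_iff
    (d m : ℕ) (hd : 2 ≤ d) (hm : 1 ≤ m)
    (L' : Set (Fin (d + m) → ℝ)) (hL' : IsAffineLattice L')
    (L₀ : Set (Fin (d + m) → ℝ))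
    (hL₀ : L₀ = {z | ∃ y ∈ L', ∃ y' ∈ L', z = y - y'})
    (W : Set (Fin m → ℝ)) (hWne : W.Nonempty)
    (hWopen : ∃ U : Set (Fin m → ℝ), IsOpen U ∧
      W = U ∩ closure (projInt d m '' L')) :
    Set.InjOn (projPhys d m) {y ∈ L' | projInt d m y ∈ W} ↔
      {w | ∃ w₁ ∈ W, ∃ w₂ ∈ W, w = w₁ - w₂} ∩
        (projInt d m '' (L₀ ∩ {y | ∀ i : Fin d, y (Fin.castAdd m i) = 0})) = {0} := by
  obtain ⟨U, hU, rfl⟩ := hWopen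
  subst hL₀
  constructor
  · intro hinj
    apply Set.Subset.antisymm
    · rintro _ ⟨⟨w₁, hw₁, w₂, hw₂, hw⟩, z, ⟨⟨a, ha, b, hb, rfl⟩, hz⟩, rfl⟩
      have hV : IsOpen (U ∩ (fun x => x - projInt d m (a - b)) ⁻¹' U) :=
        hU.inter (hU.preimage (by fun_prop))
      have hmem : w₁ ∈ U ∩ (fun x => x - projInt d m (a - b)) ⁻¹' U := by
        refine ⟨hw₁.1, ?_⟩
        change w₁ - projInt d m (a - b) ∈ U
        rw [hw, sub_sub_cancel]
        exact hw₂.1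
      obtain ⟨_, ⟨hyU, hyU'⟩, y, hy, rfl⟩ := mem_closure_iff.1 hw₁.2 _ hV hmem
      have hy' := hL'.sub_sub_mem hy ha hb
      have hphys : projPhys d m y = projPhys d m (y - (a - b)) := by
        ext i
        have hi : (a - b) (Fin.castAdd m i) = 0 := hz i
        change y _ = y _ - (a - b) _
        rw [hi, sub_zero]
      have heq := hinj ⟨hy, hyU, subset_closure ⟨y, hy, rfl⟩⟩
        ⟨hy', hyU', subset_closure ⟨_, hy', rfl⟩⟩ hphys
      rw [eq_comm, sub_eq_self] at heq
      rw [heq]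
      rfl
    · rintro _ rfl
      obtain ⟨w, hw⟩ := hWne
      obtain ⟨_, y, hy, rfl⟩ := closure_nonempty_iff.1 ⟨w, hw.2⟩
      exact ⟨⟨w, hw, w, hw, (sub_self w).symm⟩,
        0, ⟨⟨y, hy, y, hy, (sub_self y).symm⟩, fun _ => rfl⟩, rfl⟩
  · rintro h y ⟨hy, hyW⟩ z ⟨hz, hzW⟩ hyz
    have hmem : projInt d m (y - z) ∈ ({0} : Set (Fin m → ℝ)) := by
      rw [← h]
      exact ⟨⟨_, hyW, _, hzW, rfl⟩, _, ⟨⟨y, hy, z, hz, rfl⟩,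
        fun i => sub_eq_zero.2 (congrFun hyz i)⟩, rfl⟩
    exact eq_of_projPhys_eq_of_projInt_eq hyz (sub_eq_zero.1 hmem)
end
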